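/- arXiv:1704.05532 — 9 statements merged into one kernel-verified Lean document; each statement's English description precedes it below -/
import Mathlib

section
/- For every integer n ≥ 3 there exists an n-dimensional smooth lattice polytope P ⊂ ℝ^n and a polynomial p ∈ ℚ[t] of degree n such that p(t) = |tP ∩ ℤ^n| for every positive integer t, and the coefficient of t^j in p is strictly negative for every j = 1, …, n−2. -/
open Pointwise Polynomial

/-- The canonical embedding of integer vectors into real vectors. -/
def intVec {n : ℕ} (z : Fin n → ℤ) : Fin n → ℝ := fun i => (z i : ℝ)

/-- The number of lattice points `|tP ∩ ℤ^n|` in the `t`-th dilate of `P ⊆ ℝ^n`. -/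
noncomputable def latticePointCount {n : ℕ} (P : Set (Fin n → ℝ)) (t : ℕ) : ℕ :=
  {z : Fin n → ℤ | intVec z ∈ (t : ℝ) • P}.ncard

/-- A lattice polytope is the convex hull of a finite set of integer points. -/
def IsLatticePolytope {n : ℕ} (P : Set (Fin n → ℝ)) : Prop :=
  ∃ V : Finset (Fin n → ℤ), P = convexHull ℝ (intVec '' (V : Set (Fin n → ℤ)))

/-- `u 0, …, u (n-1)` form a `ℤ`-basis of `ℤ^n`, i.e. the matrix with these rows
is invertible over `ℤ`. -/
def IsZBasis {n : ℕ} (u : Fin n → Fin n → ℤ) : Prop :=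
  IsUnit (Matrix.of u).det

/-- A polytope is smooth if at each vertex (extreme point) `v` there are a `ℤ`-basis
`u 0, …, u (n-1)` of `ℤ^n` and a `δ > 0` such that near `v` the polytope agrees with
the translated cone `v + {∑ i, c i • u i : c i ≥ 0}`. -/
def IsSmooth {n : ℕ} (P : Set (Fin n → ℝ)) : Prop :=
  ∀ v ∈ Set.extremePoints ℝ P,
    ∃ (u : Fin n → Fin n → ℤ) (δ : ℝ), 0 < δ ∧ IsZBasis u ∧
      P ∩ Metric.ball v δ =
        {x : Fin n → ℝ | ∃ c : Fin n → ℝ, (∀ i, 0 ≤ c i) ∧ x = v + ∑ i, c i • intVec (u i)}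
          ∩ Metric.ball v δ

/-- The polytope in `ℝ × ℝ^m` whose slice at height `z ∈ [0, 1]` is the box
`∏ i, [0, a i + b i * z]`. -/
def boxBundle {m : ℕ} (a b : Fin m → ℤ) : Set (Fin (m + 1) → ℝ) :=
  {x | (0 ≤ x 0 ∧ x 0 ≤ 1) ∧ ∀ i : Fin m, 0 ≤ x i.succ ∧ x i.succ ≤ a i + b i * x 0}

/-- The vertex of `boxBundle a b` at height `0` or `1` (according to `e₀`) whose remaining
coordinates are minimal or maximal (according to `e`). -/
def boxBundleVertex {m : ℕ} (a b : Fin m → ℤ) (e₀ : Bool) (e : Fin m → Bool) :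
    Fin (m + 1) → ℤ :=
  Fin.cons (if e₀ then 1 else 0)
    fun i => if e i then a i + b i * (if e₀ then 1 else 0) else 0

/-- The primitive edge directions of `boxBundle a b` at a vertex. -/
def boxBundleEdge {m : ℕ} (b : Fin m → ℤ) (e₀ : Bool) (e : Fin m → Bool) :
    Fin (m + 1) → Fin (m + 1) → ℤ :=
  Fin.cons
    (Fin.cons (if e₀ then -1 else 1) fun j => if e j then (if e₀ then -1 else 1) * b j else 0)
    fun i => Fin.cons 0 (Pi.single i (if e i then -1 else 1))

section BoxBundle

variable {m : ℕ} (a b : Fin m → ℤ)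

lemma convex_boxBundle : Convex ℝ (boxBundle a b) := by
  rintro x ⟨⟨hx0, hx1⟩, hx⟩ y ⟨⟨hy0, hy1⟩, hy⟩ p q hp hq hpq
  refine ⟨⟨?_, ?_⟩, fun i => ⟨?_, ?_⟩⟩ <;>
    simp only [Pi.add_apply, Pi.smul_apply, smul_eq_mul]
  · positivity
  · nlinarith
  · have := (hx i).1
    have := (hy i).1
    positivity
  · have h1 := mul_le_mul_of_nonneg_left (hx i).2 hp
    have h2 := mul_le_mul_of_nonneg_left (hy i).2 hq
    have h3 : (a i : ℝ) = p * a i + q * a i := by rw [← add_mul, hpq, one_mul]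
    rw [h3]
    linarith

variable {a b}

lemma boxBundleVertex_mem (ha : ∀ i, 1 ≤ a i) (hab : ∀ i, 1 ≤ a i + b i) (e₀ : Bool)
    (e : Fin m → Bool) : intVec (boxBundleVertex a b e₀ e) ∈ boxBundle a b := by
  refine ⟨?_, fun i => ?_⟩
  · cases e₀ <;> simp [intVec, boxBundleVertex]
  · have h1 : (1 : ℝ) ≤ a i := by exact_mod_cast ha i
    have h2 : (1 : ℝ) ≤ a i + b i := by exact_mod_cast hab i
    cases e₀ <;> cases h : e i <;> norm_num [intVec, boxBundleVertex, h] <;>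
      first | exact_mod_cast (zero_le_one.trans h1) | linarith

/-- A horizontal end slice of `boxBundle a b` lies in the convex hull of the vertices. -/
lemma cons_mem_convexHull_boxBundleVertex (e₀ : Bool) (y : Fin m → ℝ)
    (hy : ∀ i, 0 ≤ y i ∧ y i ≤ a i + b i * (if e₀ then 1 else 0)) :
    (Fin.cons (if e₀ then 1 else 0) y : Fin (m + 1) → ℝ) ∈
      convexHull ℝ (Set.range fun p : Bool × (Fin m → Bool) =>
        intVec (boxBundleVertex a b p.1 p.2)) := by
  have hmem : (Fin.cons (if e₀ then 1 else 0) y : Fin (m + 1) → ℝ) ∈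
      convexHull ℝ (Set.univ.pi (Fin.cons {if e₀ then 1 else 0}
        fun i => {0, (a i + b i * (if e₀ then 1 else 0) : ℝ)} :
          Fin (m + 1) → Set ℝ)) := by
    rw [convexHull_pi]
    intro i _
    refine Fin.cases ?_ (fun i => ?_) i
    · simp
    · have h := hy i
      simp only [Fin.cons_succ]
      rw [convexHull_pair, segment_eq_Icc (h.1.trans h.2)]
      exact h
  refine convexHull_mono ?_ hmem
  intro x hx
  refine ⟨(e₀, fun i => decide (x i.succ ≠ 0)), ?_⟩
  funext i
  refine Fin.cases ?_ (fun i => ?_) i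
  · have := hx 0 trivial
    simp only [Fin.cons_zero, Set.mem_singleton_iff] at this
    rw [this]
    cases e₀ <;> simp [intVec, boxBundleVertex]
  · have := hx i.succ trivial
    simp only [Fin.cons_succ, Set.mem_insert_iff, Set.mem_singleton_iff] at this
    by_cases h0 : x i.succ = 0
    · simp [intVec, boxBundleVertex, h0]
    · rw [this.resolve_left h0]
      cases e₀ <;> simp_all [intVec, boxBundleVertex]

lemma boxBundle_eq_convexHull (ha : ∀ i, 1 ≤ a i) (hab : ∀ i, 1 ≤ a i + b i) :
    boxBundle a b = convexHull ℝ (Set.range fun p : Bool × (Fin m → Bool) =>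
      intVec (boxBundleVertex a b p.1 p.2)) := by
  apply Set.Subset.antisymm
  · rintro x ⟨⟨hx0, hx1⟩, hx⟩
    set h : Fin m → ℝ := fun i => a i + b i * x 0
    have hpos : ∀ i, 0 < h i := fun i => by
      have h1 : (1 : ℝ) ≤ a i := by exact_mod_cast ha i
      have h2 : (1 : ℝ) ≤ a i + b i := by exact_mod_cast hab i
      simp only [h]
      nlinarith
    have h_slice : ∀ e₀ : Bool, (Fin.cons (if e₀ then 1 else 0)
        (fun i => x i.succ / h i * (a i + b i * (if e₀ then 1 else 0))) : Fin (m + 1) → ℝ) ∈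
        convexHull ℝ (Set.range fun p : Bool × (Fin m → Bool) =>
          intVec (boxBundleVertex a b p.1 p.2)) := fun e₀ => by
      apply cons_mem_convexHull_boxBundleVertex
      intro i
      have hθ0 : 0 ≤ x i.succ / h i := div_nonneg (hx i).1 (hpos i).le
      have hθ1 : x i.succ / h i ≤ 1 := (div_le_one (hpos i)).2 (hx i).2
      have hr : (0 : ℝ) ≤ a i + b i * (if e₀ then 1 else 0) := by
        have h1 : (1 : ℝ) ≤ a i := by exact_mod_cast ha i
        have h2 : (1 : ℝ) ≤ a i + b i := by exact_mod_cast hab i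
        split_ifs <;> linarith
      exact ⟨mul_nonneg hθ0 hr, mul_le_of_le_one_left hr hθ1⟩
    convert convex_convexHull ℝ _ (h_slice false) (h_slice true) (sub_nonneg.2 hx1) hx0
      (by ring) using 1
    funext i
    refine Fin.cases ?_ (fun i => ?_) i
    · simp
    · have := (hpos i).ne'
      simp only [Pi.add_apply, Pi.smul_apply, smul_eq_mul, Fin.cons_succ]
      field_simp
      simp only [h, Bool.false_eq_true, if_false, if_true]
      ring
  · apply convexHull_min _ (convex_boxBundle a b)
    rintro _ ⟨p, rfl⟩
    exact boxBundleVertex_mem ha hab p.1 p.2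

lemma isLatticePolytope_boxBundle (ha : ∀ i, 1 ≤ a i) (hab : ∀ i, 1 ≤ a i + b i) :
    IsLatticePolytope (boxBundle a b) := by
  classical
  refine ⟨Finset.univ.image fun p : Bool × (Fin m → Bool) => boxBundleVertex a b p.1 p.2, ?_⟩
  rw [boxBundle_eq_convexHull ha hab, Finset.coe_image, Finset.coe_univ, Set.image_univ,
    ← Set.range_comp]
  rfl

lemma affineSpan_boxBundle (ha : ∀ i, 1 ≤ a i) (hab : ∀ i, 1 ≤ a i + b i) :
    affineSpan ℝ (boxBundle a b) = ⊤ := by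
  set U : Set (Fin (m + 1) → ℝ) := {x | (0 < x 0 ∧ x 0 < 1) ∧
    ∀ i : Fin m, 0 < x i.succ ∧ x i.succ < a i + b i * x 0}
  have hU : IsOpen U := by
    simp only [U, Set.ofPred_and, Set.ofPred_forall]
    refine .inter (.inter ?_ ?_) (isOpen_iInter_of_finite fun i => .inter ?_ ?_) <;>
      exact isOpen_lt (by fun_prop) (by fun_prop)
  have hne : U.Nonempty := by
    refine ⟨fun _ => 1 / 2, by norm_num, fun i => ⟨by norm_num, ?_⟩⟩
    have h1 : (1 : ℝ) ≤ a i := by exact_mod_cast ha i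
    have h2 : (1 : ℝ) ≤ a i + b i := by exact_mod_cast hab i
    linarith
  refine top_unique ((hU.affineSpan_eq_top hne).symm.le.trans (affineSpan_mono ℝ ?_))
  exact fun x hx => ⟨⟨hx.1.1.le, hx.1.2.le⟩, fun i => ⟨(hx.2 i).1.le, (hx.2 i).2.le⟩⟩

variable (b) in
lemma isZBasis_boxBundleEdge (e₀ : Bool) (e : Fin m → Bool) :
    IsZBasis (boxBundleEdge b e₀ e) := by
  have htri : (Matrix.of (boxBundleEdge b e₀ e)).BlockTriangular id := by
    intro i j hij
    refine Fin.cases (fun h => absurd h (Fin.not_lt_zero _)) (fun i h => ?_) i hij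
    revert h
    refine Fin.cases (fun _ => ?_) (fun j h => ?_) j
    · simp [boxBundleEdge]
    · have : j ≠ i := fun hji => by simp [hji] at h
      simp [boxBundleEdge, this]
  rw [IsZBasis, Matrix.det_of_isUpperTriangular htri, Fin.prod_univ_succ]
  refine IsUnit.mul ?_ (IsUnit.prod_univ_iff.2 fun i => ?_)
  · cases e₀ <;> simp [boxBundleEdge]
  · cases h : e i <;> simp [boxBundleEdge, h]

variable (b) in
lemma sum_smul_boxBundleEdge_zero (e₀ : Bool) (e : Fin m → Bool) (c : Fin (m + 1) → ℝ) :
    (∑ i, c i • intVec (boxBundleEdge b e₀ e i)) 0 = c 0 * (if e₀ then -1 else 1) := by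
  simp [Finset.sum_apply, Fin.sum_univ_succ, intVec, boxBundleEdge]

variable (b) in
lemma sum_smul_boxBundleEdge_succ (e₀ : Bool) (e : Fin m → Bool) (c : Fin (m + 1) → ℝ)
    (j : Fin m) :
    (∑ i, c i • intVec (boxBundleEdge b e₀ e i)) j.succ =
      (if e j then c 0 * (if e₀ then -1 else 1) * b j else 0) +
        c j.succ * (if e j then -1 else 1) := by
  rw [Finset.sum_apply, Fin.sum_univ_succ, Finset.sum_eq_single j]
  · cases e₀ <;> cases h : e j <;> simp [intVec, boxBundleEdge, h]
  · intro i _ hij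
    simp [intVec, boxBundleEdge, hij.symm]
  · simp

/-- The cone at a vertex of `boxBundle a b` is cut out by the facet inequalities active there. -/
lemma mem_cone_boxBundleVertex_iff (e₀ : Bool) (e : Fin m → Bool) (x : Fin (m + 1) → ℝ) :
    (∃ c : Fin (m + 1) → ℝ, (∀ i, 0 ≤ c i) ∧ x = intVec (boxBundleVertex a b e₀ e) +
      ∑ i, c i • intVec (boxBundleEdge b e₀ e i)) ↔
    (if e₀ then x 0 ≤ 1 else 0 ≤ x 0) ∧
      ∀ i : Fin m, if e i then x i.succ ≤ a i + b i * x 0 else 0 ≤ x i.succ := by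
  constructor
  · rintro ⟨c, hc, rfl⟩
    have h0 := hc 0
    simp only [Pi.add_apply, sum_smul_boxBundleEdge_zero, sum_smul_boxBundleEdge_succ]
    refine ⟨?_, fun i => ?_⟩
    · cases e₀ <;> simp [intVec, boxBundleVertex, h0]
    · have hi := hc i.succ
      cases e₀ <;> cases h : e i <;> simp [intVec, boxBundleVertex, h, hi] <;> nlinarith
  · rintro ⟨h0, hx⟩
    refine ⟨Fin.cons (if e₀ then 1 - x 0 else x 0)
      fun i => if e i then a i + b i * x 0 - x i.succ else x i.succ, ?_, ?_⟩
    · intro i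
      refine Fin.cases ?_ (fun i => ?_) i
      · cases e₀ <;> simpa using h0
      · have hi := hx i
        cases h : e i <;> simpa [h] using hi
    · funext i
      rw [Pi.add_apply]
      refine Fin.cases ?_ (fun i => ?_) i
      · rw [sum_smul_boxBundleEdge_zero]
        cases e₀ <;> simp [intVec, boxBundleVertex]
      · rw [sum_smul_boxBundleEdge_succ]
        cases e₀ <;> cases h : e i <;> simp [intVec, boxBundleVertex, h] <;> ring

lemma isSmooth_boxBundle (ha : ∀ i, 1 ≤ a i) (hab : ∀ i, 1 ≤ a i + b i) :
    IsSmooth (boxBundle a b) := by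
  intro v hv
  rw [boxBundle_eq_convexHull ha hab] at hv
  obtain ⟨⟨e₀, e⟩, rfl⟩ := extremePoints_convexHull_subset hv
  set B : ℝ := ∑ i, |(b i : ℝ)|
  have hB : 0 ≤ B := Finset.sum_nonneg fun i _ => abs_nonneg _
  set δ : ℝ := 1 / (B + 1)
  have hδ : 0 < δ := by positivity
  have hδB : B * δ + δ = 1 := by simp only [δ]; field_simp
  have hδ1 : δ ≤ 1 := by nlinarith
  refine ⟨boxBundleEdge b e₀ e, δ, hδ, isZBasis_boxBundleEdge b e₀ e, ?_⟩
  ext x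
  simp only [Set.mem_inter_iff, Set.mem_ofPred_eq, mem_cone_boxBundleVertex_iff]
  refine and_congr_left fun hball => ⟨fun hx => ⟨?_, fun i => ?_⟩, fun hx => ?_⟩
  · cases e₀ <;> simp [hx.1]
  · cases h : e i <;> simp [hx.2 i]
  · rw [Metric.mem_ball, dist_pi_lt_iff hδ] at hball
    have hx0 := abs_lt.1 (Real.dist_eq _ _ ▸ hball 0)
    refine ⟨?_, fun i => ?_⟩
    · have h := hx.1
      cases e₀ <;> simp [intVec, boxBundleVertex] at h hx0 ⊢ <;> constructor <;> linarith
    · have hxi := abs_lt.1 (Real.dist_eq _ _ ▸ hball i.succ)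
      have h := hx.2 i
      have h1 : (1 : ℝ) ≤ a i := by exact_mod_cast ha i
      have h2 : (1 : ℝ) ≤ a i + b i := by exact_mod_cast hab i
      have hbB : |(b i : ℝ)| ≤ B :=
        Finset.single_le_sum (f := fun i => |(b i : ℝ)|) (fun i _ => abs_nonneg _)
          (Finset.mem_univ i)
      have hdev : |(b i : ℝ) * (x 0 - intVec (boxBundleVertex a b e₀ e) 0)| ≤ B * δ := by
        rw [abs_mul]
        exact mul_le_mul hbB (abs_lt.2 hx0).le (abs_nonneg _) hB
      have hdev := abs_le.1 hdev
      cases e₀ <;> cases he : e i <;> simp [intVec, boxBundleVertex, he] at h hxi hdev ⊢ <;>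
        constructor <;> linarith

lemma mem_smul_boxBundle_iff {t : ℝ} (ht : 0 < t) (y : Fin (m + 1) → ℝ) :
    y ∈ t • boxBundle a b ↔ (0 ≤ y 0 ∧ y 0 ≤ t) ∧
      ∀ i : Fin m, 0 ≤ y i.succ ∧ y i.succ ≤ a i * t + b i * y 0 := by
  rw [Set.mem_smul_set_iff_inv_smul_mem₀ ht.ne']
  simp only [boxBundle, Set.mem_ofPred_eq, Pi.smul_apply, smul_eq_mul]
  have h : ∀ u w : ℝ, t⁻¹ * u ≤ w ↔ u ≤ t * w := fun u w => inv_mul_le_iff₀ ht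
  have h' : ∀ u : ℝ, 0 ≤ t⁻¹ * u ↔ 0 ≤ u := fun u => mul_nonneg_iff_of_pos_left (inv_pos.2 ht)
  simp only [h, h', mul_one]
  refine and_congr_right fun _ => forall_congr' fun i => and_congr_right fun _ => ?_
  rw [show t * (a i + b i * (t⁻¹ * y 0)) = a i * t + b i * y 0 by field_simp]

lemma latticePointCount_boxBundle {t : ℕ} (ht : 0 < t) :
    latticePointCount (boxBundle a b) t =
      ∑ z ∈ Finset.range (t + 1), ∏ i, (a i * t + b i * z + 1).toNat := by
  classical
  have hset : {z : Fin (m + 1) → ℤ | intVec z ∈ (t : ℝ) • boxBundle a b} =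
      (((Finset.range (t + 1)).sigma fun z =>
        Fintype.piFinset fun i => Finset.Icc (0 : ℤ) (a i * t + b i * z)).image
        fun p => (Fin.cons (p.1 : ℤ) p.2 : Fin (m + 1) → ℤ) : Finset _) := by
    ext z
    rw [Set.mem_ofPred_eq, mem_smul_boxBundle_iff (by exact_mod_cast ht)]
    simp only [intVec, Finset.coe_image, Set.mem_image, Finset.mem_coe, Finset.mem_sigma,
      Finset.mem_range, Fintype.mem_piFinset, Finset.mem_Icc]
    constructor
    · rintro ⟨⟨h0, h1⟩, h⟩
      norm_cast at h0 h1
      refine ⟨⟨(z 0).toNat, Fin.tail z⟩, ⟨by simp only; omega, fun i => ?_⟩, ?_⟩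
      · have := h i
        rw [Int.toNat_of_nonneg h0]
        exact_mod_cast this
      · simp only [Int.toNat_of_nonneg h0]
        exact Fin.cons_self_tail z
    · rintro ⟨⟨w, y⟩, ⟨hw, hy⟩, rfl⟩
      simp only at hw hy
      simp only [Fin.cons_zero, Fin.cons_succ]
      refine ⟨⟨by positivity, by exact_mod_cast Nat.lt_succ_iff.1 hw⟩, fun i => ?_⟩
      exact_mod_cast hy i
  rw [latticePointCount, hset, Set.ncard_coe_finset, Finset.card_image_of_injective,
    Finset.card_sigma]
  · simp [Fintype.card_piFinset]
  · rintro ⟨w, y⟩ ⟨w', y'⟩ h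
    obtain ⟨h1, h2⟩ := Fin.cons_inj.1 h
    simp only [Nat.cast_inj] at h1
    subst h1 h2
    rfl

end BoxBundle

lemma sum_range_mul_sub (A B s : ℚ) (T : ℕ) :
    ∑ z ∈ Finset.range T, (A + s * z) * (B - s * z) =
      T * (A * B) + s * (B - A) * (T * (T - 1) / 2) - s ^ 2 * ((T - 1) * T * (2 * T - 1) / 6) := by
  induction T with
  | zero => simp
  | succ T ih =>
    rw [Finset.sum_range_succ, ih]
    push_cast
    ring

lemma coeff_C_mul_X_add_one_pow (l : ℚ) (k j : ℕ) :
    ((C l * X + 1 : ℚ[X]) ^ k).coeff j = l ^ j * k.choose j := by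
  have : (C l * X + 1 : ℚ[X]) ^ k = ((X + 1) ^ k).comp (C l * X) := by simp
  rw [this, comp_C_mul_X_coeff, coeff_X_add_one_pow, mul_comm]

/-- The Ehrhart polynomial of the product of a cube with a three-dimensional box bundle. -/
noncomputable def cubeBundlePoly (k : ℕ) (l r : ℚ) : ℚ[X] :=
  (C l * X + 1) ^ k *
    (C (6 * r ^ 2 + 6 * r + 1) * X ^ 3 + C (12 * r + 3) * X ^ 2 +
      C (-(6 * r ^ 2 - 6 * r - 3)) * X + 1)

lemma natDegree_cubeBundlePoly (k : ℕ) {l r : ℚ} (hl : 0 < l) (hr : 0 < r) :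
    (cubeBundlePoly k l r).natDegree = k + 3 := by
  have h1 : (C l * X + 1 : ℚ[X]).natDegree = 1 := by
    compute_degree!
    exact hl.ne'
  have h2 : (C (6 * r ^ 2 + 6 * r + 1) * X ^ 3 + C (12 * r + 3) * X ^ 2 +
      C (-(6 * r ^ 2 - 6 * r - 3)) * X + 1 : ℚ[X]).natDegree = 3 := by
    compute_degree!
    positivity
  rw [cubeBundlePoly, natDegree_mul, natDegree_pow, h1, h2, mul_one]
  · refine pow_ne_zero _ fun h => ?_
    simp [h] at h1
  · intro h
    rw [h] at h2
    simp at h2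

lemma coeff_cubeBundlePoly_neg (k : ℕ) {l r : ℚ} (hl : l = 4 * 2 ^ k) (hr : r = l ^ 2)
    {j : ℕ} (hj1 : 1 ≤ j) (hjk : j ≤ k + 1) : (cubeBundlePoly k l r).coeff j < 0 := by
  obtain ⟨j, rfl⟩ := Nat.exists_eq_add_of_le' hj1
  have hjk : j ≤ k := by omega
  set K : ℚ := 2 ^ k
  have hK : 1 ≤ K := one_le_pow₀ (by norm_num)
  have hchoose : ∀ i, (k.choose i : ℚ) ≤ K := fun i => by
    simp only [K]
    exact_mod_cast Nat.choose_le_two_pow k i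
  have hpos : (1 : ℚ) ≤ k.choose j := by exact_mod_cast Nat.choose_pos hjk
  have hl4 : 4 ≤ l := by linarith
  have hl0 : 0 < l := by linarith
  have hr16 : 16 ≤ r := by nlinarith
  have hKl : K = l / 4 := by linarith
  set f : ℕ → ℚ := fun i => l ^ i * k.choose i
  have hub : ∀ i, f i ≤ l ^ i * (l / 4) := fun i =>
    mul_le_mul_of_nonneg_left (hKl ▸ hchoose i) (by positivity)
  have hlb : l ^ j ≤ f j := le_mul_of_one_le_right (by positivity) hpos
  have hlj : 0 < l ^ j := by positivity
  -- the two contributions of degree at least two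
  have h2 : ((C l * X + 1 : ℚ[X]) ^ k * X ^ 2).coeff (j + 1) ≤ l ^ j / 4 := by
    rw [coeff_mul_X_pow']
    split_ifs with h
    · obtain ⟨i, rfl⟩ : ∃ i, j = i + 1 := ⟨j - 1, by omega⟩
      rw [coeff_C_mul_X_add_one_pow, show i + 1 + 1 - 2 = i by omega, pow_succ]
      linarith [hub i]
    · positivity
  have h3 : ((C l * X + 1 : ℚ[X]) ^ k * X ^ 3).coeff (j + 1) ≤ l ^ j / 16 := by
    rw [coeff_mul_X_pow']
    split_ifs with h
    · obtain ⟨i, rfl⟩ : ∃ i, j = i + 2 := ⟨j - 2, by omega⟩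
      rw [coeff_C_mul_X_add_one_pow, show i + 2 + 1 - 3 = i by omega, pow_add]
      have hp : 0 < l ^ i := by positivity
      have := hub i
      have hl2 := mul_le_mul_of_nonneg_left (show l / 4 ≤ l ^ 2 / 16 by nlinarith) hp.le
      simp only [f] at this
      linarith
    · positivity
  have hexp : cubeBundlePoly k l r =
      C (6 * r ^ 2 + 6 * r + 1) * ((C l * X + 1) ^ k * X ^ 3) +
      C (12 * r + 3) * ((C l * X + 1) ^ k * X ^ 2) +
      C (-(6 * r ^ 2 - 6 * r - 3)) * ((C l * X + 1) ^ k * X) + (C l * X + 1) ^ k := by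
    rw [cubeBundlePoly]
    ring
  rw [hexp]
  simp only [coeff_add, coeff_C_mul, coeff_mul_X]
  rw [coeff_C_mul_X_add_one_pow l k j, coeff_C_mul_X_add_one_pow]
  have e3 := mul_le_mul_of_nonneg_left h3 (show 0 ≤ 6 * r ^ 2 + 6 * r + 1 by positivity)
  have e2 := mul_le_mul_of_nonneg_left h2 (show 0 ≤ 12 * r + 3 by positivity)
  have e1 := mul_le_mul_of_nonneg_left hlb (show 0 ≤ 6 * r ^ 2 - 6 * r - 3 by nlinarith)
  have e0 : f (j + 1) ≤ l ^ j * (r / 4) := by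
    have := hub (j + 1)
    rw [pow_succ] at this
    rw [hr]
    linarith
  have hfin : 0 < l ^ j * ((6 * r ^ 2 - 6 * r - 3) - (6 * r ^ 2 + 6 * r + 1) / 16 -
      (12 * r + 3) / 4 - r / 4) := mul_pos hlj (by nlinarith)
  simp only [f] at e1 e0
  linarith

/-- In each dimension `n ≥ 3` there is an `n`-dimensional smooth lattice polytope
`P ⊆ ℝ^n` whose Ehrhart polynomial has strictly negative coefficients of `t^j`
for all `j = 1, …, n − 2`. -/
theorem smooth_polytope_with_negative_ehrhart_coeffs (n : ℕ) (hn : 3 ≤ n) :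
    ∃ P : Set (Fin n → ℝ),
      IsLatticePolytope P ∧ affineSpan ℝ P = ⊤ ∧ IsSmooth P ∧
      ∃ p : Polynomial ℚ, p.natDegree = n ∧
        (∀ t : ℕ, 0 < t → p.eval (t : ℚ) = latticePointCount P t) ∧
        ∀ j : ℕ, 1 ≤ j → j ≤ n - 2 → p.coeff j < 0 := by
  obtain ⟨k, rfl⟩ := Nat.exists_eq_add_of_le' hn
  set l : ℤ := 4 * 2 ^ k with hl
  set r : ℤ := l ^ 2 with hr
  have hl1 : 1 ≤ l := by
    have : (1 : ℤ) ≤ 2 ^ k := one_le_pow₀ (by norm_num)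
    linarith
  have hr1 : 1 ≤ r := one_le_pow₀ hl1
  set a : Fin (k + 2) → ℤ := Fin.cons 1 (Fin.cons (1 + 6 * r) fun _ => l) with ha_def
  set b : Fin (k + 2) → ℤ := Fin.cons (6 * r) (Fin.cons (-(6 * r)) fun _ => 0) with hb_def
  have ha : ∀ i, 1 ≤ a i := by
    refine Fin.cases ?_ (Fin.cases ?_ fun i => ?_) <;>
      simp only [ha_def, Fin.cons_zero, Fin.cons_succ] <;> linarith
  have hab : ∀ i, 1 ≤ a i + b i := by
    refine Fin.cases ?_ (Fin.cases ?_ fun i => ?_) <;>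
      simp only [ha_def, hb_def, Fin.cons_zero, Fin.cons_succ] <;> linarith
  have hlq : (l : ℚ) = 4 * 2 ^ k := by simp [hl]
  have hrq : (r : ℚ) = (l : ℚ) ^ 2 := by simp [hr]
  refine ⟨boxBundle a b, isLatticePolytope_boxBundle ha hab, affineSpan_boxBundle ha hab,
    isSmooth_boxBundle ha hab, cubeBundlePoly k l r,
    natDegree_cubeBundlePoly k (by exact_mod_cast hl1) (by exact_mod_cast hr1), ?_,
    fun j hj1 hj2 => coeff_cubeBundlePoly_neg k hlq hrq hj1 (by omega)⟩
  intro t ht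
  have hcast : ∀ z ∈ Finset.range (t + 1),
      ((∏ i, (a i * t + b i * z + 1).toNat : ℕ) : ℚ) =
        (l * t + 1) ^ k * (((t + 1 : ℚ) + (6 * r : ℚ) * z) *
          (((1 + 6 * r) * t + 1 : ℚ) - (6 * r : ℚ) * z)) := by
    intro z hz
    have hzt : (z : ℤ) ≤ t := by exact_mod_cast Nat.lt_succ_iff.1 (Finset.mem_range.1 hz)
    have hnonneg : ∀ i, 0 ≤ a i * t + b i * z + 1 := fun i => by
      have h1 := mul_nonneg (by linarith [ha i] : 0 ≤ a i) (sub_nonneg.2 hzt)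
      have h2 := mul_nonneg (by linarith [hab i] : 0 ≤ a i + b i) (Int.natCast_nonneg z)
      linarith
    have hprod : ((∏ i, (a i * t + b i * z + 1).toNat : ℕ) : ℤ) =
        ∏ i, (a i * t + b i * z + 1) := by
      rw [Nat.cast_prod]
      exact Finset.prod_congr rfl fun i _ => Int.toNat_of_nonneg (hnonneg i)
    rw [← Int.cast_natCast, hprod, Fin.prod_univ_succ, Fin.prod_univ_succ]
    simp only [ha_def, hb_def, Fin.cons_zero, Fin.cons_succ, Finset.prod_const,
      Finset.card_univ, Fintype.card_fin]
    push_cast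
    ring
  rw [latticePointCount_boxBundle ht, Nat.cast_sum, Finset.sum_congr rfl hcast,
    ← Finset.mul_sum, sum_range_mul_sub]
  simp only [cubeBundlePoly, eval_mul, eval_pow, eval_add, eval_C, eval_X, eval_one]
  push_cast
  ring
end

section
/- Let integers a > 2b > 0 and n ≥ 1, and let Q_n(a,b) = {x ∈ ℝ^n : 0 ≤ x_i ≤ a for all i, and for every ε ∈ {0,1}^n, Σ_{i=1}^n (ε_i(a − x_i) + (1 − ε_i)x_i) ≥ b}. Then for every positive integer t, |tQ_n(a,b) ∩ ℤ^n| = (at+1)^n − 2^n · C(bt+n−1, n). -/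
open Pointwise Polynomial

/-- The polytope `Q_n(a,b)` obtained from the dilated cube `[0,a]^n` by chiseling off
every vertex at lattice distance `b`. -/
def chiseledCube (n : ℕ) (a b : ℕ) : Set (Fin n → ℝ) :=
  {x | (∀ i, 0 ≤ x i ∧ x i ≤ (a : ℝ)) ∧
    ∀ ε : Fin n → Bool, (b : ℝ) ≤ ∑ i, if ε i then (a : ℝ) - x i else x i}

/-- The involution of `ℤ^n` that replaces the coordinates `z i` selected by `ε` by `N - z i`. -/
def reflectCoords {n : ℕ} (N : ℤ) (ε : Fin n → Bool) (z : Fin n → ℤ) : Fin n → ℤ :=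
  fun i => if ε i then N - z i else z i

theorem reflectCoords_involutive {n : ℕ} (N : ℤ) (ε : Fin n → Bool) :
    Function.Involutive (reflectCoords N ε) := by
  intro z
  ext i
  by_cases h : ε i <;> simp [reflectCoords, h]

/-- The vectors of natural numbers with coordinate sum less than `k`. -/
def natSimplex (n k : ℕ) : Finset (Fin n →₀ ℕ) :=
  (Finset.range k).biUnion fun j => Finset.finsuppAntidiag Finset.univ j

theorem mem_natSimplex {n k : ℕ} {f : Fin n →₀ ℕ} : f ∈ natSimplex n k ↔ ∑ i, f i < k := by
  simp [natSimplex]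

theorem card_natSimplex (n k : ℕ) (hk : 0 < k) :
    (natSimplex n k).card = (k + n - 1).choose n := by
  obtain ⟨m, rfl⟩ := Nat.exists_eq_succ_of_ne_zero hk.ne'
  rw [natSimplex, Finset.card_biUnion]
  · simp only [Finset.card_finsuppAntidiag_nat_eq_multichoose, Finset.card_univ, Fintype.card_fin]
    rw [Nat.succ_eq_add_one, Nat.sum_range_multichoose]
    congr 1
    omega
  · intro i _ j _ hij
    refine Finset.disjoint_left.2 fun f hi hj => ?_
    simp only [Finset.mem_finsuppAntidiag] at hi hj
    exact hij (hi.1.symm.trans hj.1)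

/-- The lattice points of the cube `[0,N]^n` cut off at the vertex selected by `ε`, at lattice
distance less than `k`. -/
def cornerPoints (n k : ℕ) (N : ℤ) (ε : Fin n → Bool) : Finset (Fin n → ℤ) :=
  (natSimplex n k).image fun f => reflectCoords N ε fun i => (f i : ℤ)

theorem mem_cornerPoints {n k : ℕ} {N : ℤ} {ε : Fin n → Bool} {z : Fin n → ℤ} :
    z ∈ cornerPoints n k N ε ↔
      (∀ i, 0 ≤ reflectCoords N ε z i) ∧ ∑ i, reflectCoords N ε z i < k := by
  rw [cornerPoints, Finset.mem_image]
  constructor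
  · rintro ⟨f, hf, rfl⟩
    rw [mem_natSimplex] at hf
    rw [reflectCoords_involutive N ε]
    exact ⟨fun i => Int.natCast_nonneg _, by exact_mod_cast hf⟩
  · rintro ⟨h0, hs⟩
    have hcast : (fun i => ((reflectCoords N ε z i).toNat : ℤ)) = reflectCoords N ε z :=
      funext fun i => Int.toNat_of_nonneg (h0 i)
    refine ⟨Finsupp.equivFunOnFinite.symm fun i => (reflectCoords N ε z i).toNat, ?_, ?_⟩
    · rw [mem_natSimplex]
      zify
      simpa [Int.toNat_of_nonneg, h0] using hs
    · simp only [Finsupp.equivFunOnFinite_symm_apply_apply]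
      rw [hcast, reflectCoords_involutive N ε]

theorem card_cornerPoints (n k : ℕ) (hk : 0 < k) (N : ℤ) (ε : Fin n → Bool) :
    (cornerPoints n k N ε).card = (k + n - 1).choose n := by
  rw [cornerPoints, Finset.card_image_of_injective, card_natSimplex n k hk]
  intro f g hfg
  ext i
  exact_mod_cast congrFun ((reflectCoords_involutive N ε).injective hfg) i

/-- The coordinates of a point of a corner are less than `k` after reflection. -/
theorem reflectCoords_lt_of_mem_cornerPoints {n k : ℕ} {N : ℤ} {ε : Fin n → Bool}
    {z : Fin n → ℤ} (hz : z ∈ cornerPoints n k N ε) (i : Fin n) :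
    reflectCoords N ε z i < k := by
  rw [mem_cornerPoints] at hz
  exact (Finset.single_le_sum (fun j _ => hz.1 j) (Finset.mem_univ i)).trans_lt hz.2

theorem cornerPoints_subset_box {n k : ℕ} {N : ℤ} (hkN : 2 * (k : ℤ) < N) (ε : Fin n → Bool) :
    cornerPoints n k N ε ⊆ Fintype.piFinset fun _ => Finset.Icc 0 N := by
  intro z hz
  rw [Fintype.mem_piFinset]
  intro i
  have hlt := reflectCoords_lt_of_mem_cornerPoints hz i
  have hnn := (mem_cornerPoints.1 hz).1 i
  rw [Finset.mem_Icc]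
  unfold reflectCoords at hlt hnn
  split_ifs at hlt hnn <;> omega

theorem cornerPoints_disjoint {n k : ℕ} {N : ℤ} (hkN : 2 * (k : ℤ) < N) {ε δ : Fin n → Bool}
    (h : ε ≠ δ) : Disjoint (cornerPoints n k N ε) (cornerPoints n k N δ) := by
  rw [Finset.disjoint_left]
  intro z hε hδ
  obtain ⟨i, hi⟩ := Function.ne_iff.1 h
  have h1 := reflectCoords_lt_of_mem_cornerPoints hε i
  have h2 := reflectCoords_lt_of_mem_cornerPoints hδ i
  unfold reflectCoords at h1 h2
  cases hεi : ε i <;> cases hδi : δ i <;> simp_all <;> omega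

theorem intVec_mem_smul_chiseledCube {n a b t : ℕ} (ht : 0 < t) (z : Fin n → ℤ) :
    intVec z ∈ (t : ℝ) • chiseledCube n a b ↔
      (∀ i, 0 ≤ z i ∧ z i ≤ (a * t : ℤ)) ∧
        ∀ ε, (b * t : ℤ) ≤ ∑ i, reflectCoords (a * t : ℤ) ε z i := by
  have ht' : (0 : ℝ) < t := by exact_mod_cast ht
  rw [Set.mem_smul_set_iff_inv_smul_mem₀ ht'.ne']
  simp only [chiseledCube, Set.mem_ofPred_eq, Pi.smul_apply, smul_eq_mul, intVec]
  refine and_congr (forall_congr' fun i => and_congr ?_ ?_) (forall_congr' fun ε => ?_)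
  · rw [mul_nonneg_iff_of_pos_left (inv_pos.2 ht')]
    exact Int.cast_nonneg_iff
  · rw [inv_mul_le_iff₀ ht', mul_comm (t : ℝ)]
    exact_mod_cast Iff.rfl
  · have hsum : (∑ i, if ε i then (a : ℝ) - (t : ℝ)⁻¹ * z i else (t : ℝ)⁻¹ * z i) =
        (t : ℝ)⁻¹ * ((∑ i, reflectCoords (a * t : ℤ) ε z i : ℤ) : ℝ) := by
      rw [Int.cast_sum, Finset.mul_sum]
      refine Finset.sum_congr rfl fun i _ => ?_
      unfold reflectCoords
      split_ifs
      · push_cast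
        field_simp
      · rfl
    rw [hsum, le_inv_mul_iff₀ ht', mul_comm (t : ℝ)]
    exact_mod_cast Iff.rfl

/-- For integers `a > 2b > 0` and `n ≥ 1`, the number of lattice points in the `t`-th
dilate of `Q_n(a,b)` is `(at+1)^n − 2^n · C(bt+n−1, n)`. -/
theorem ehrhart_chiseledCube (a b n : ℕ) (hb : 0 < b) (hab : 2 * b < a) (hn : 1 ≤ n)
    (t : ℕ) (ht : 0 < t) :
    (latticePointCount (chiseledCube n a b) t : ℚ) =
      ((a : ℚ) * t + 1) ^ n - 2 ^ n * ((b * t + n - 1).choose n : ℚ) := by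
  have hN : 2 * ((b * t : ℕ) : ℤ) < (a * t : ℤ) := by
    have := Nat.mul_lt_mul_of_pos_right hab ht
    push_cast
    zify at this
    linarith
  have hset : {z : Fin n → ℤ | intVec z ∈ (t : ℝ) • chiseledCube n a b} =
      ↑((Fintype.piFinset fun _ : Fin n => Finset.Icc 0 (a * t : ℤ)) \
        Finset.univ.biUnion (cornerPoints n (b * t) (a * t : ℤ))) := by
    ext z
    simp only [Set.mem_ofPred_eq, intVec_mem_smul_chiseledCube ht, Finset.coe_sdiff, Set.mem_sdiff,
      Finset.mem_coe, Fintype.mem_piFinset, Finset.mem_Icc, Finset.mem_biUnion, Finset.mem_univ,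
      true_and, not_exists, mem_cornerPoints, not_and, not_lt, Nat.cast_mul]
    refine and_congr_right fun hz => forall_congr' fun ε => ⟨fun h _ => h, fun h => h fun i => ?_⟩
    have := hz i
    unfold reflectCoords
    split_ifs <;> omega
  have hsub : Finset.univ.biUnion (cornerPoints n (b * t) (a * t : ℤ)) ⊆
      Fintype.piFinset fun _ : Fin n => Finset.Icc 0 (a * t : ℤ) :=
    Finset.biUnion_subset.2 fun ε _ => cornerPoints_subset_box hN ε
  have hbox : (Fintype.piFinset fun _ : Fin n => Finset.Icc 0 (a * t : ℤ)).card =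
      (a * t + 1) ^ n := by
    rw [Fintype.card_piFinset_const, Int.card_Icc]
    congr 1
  have hcorners : (Finset.univ.biUnion (cornerPoints n (b * t) (a * t : ℤ))).card =
      2 ^ n * (b * t + n - 1).choose n := by
    rw [Finset.card_biUnion fun ε _ δ _ h => cornerPoints_disjoint hN h]
    simp [card_cornerPoints n (b * t) (Nat.mul_pos hb ht)]
  rw [latticePointCount, hset, Set.ncard_coe_finset, Finset.cast_card_sdiff hsub, hbox, hcorners]
  push_cast
  rfl
end

section
/- Let n ≥ 1 and let a_1, …, a_n, b be positive integers with b < a_i for every i. Let P = {x ∈ ℝ^n : 0 ≤ x_i ≤ a_i for all i, and Σ_{i=1}^n x_i ≥ b}, the box ∏_i [0, a_i] with the corner at the origin chiseled off at distance b. Then for every positive integer t, |tP ∩ ℤ^n| = ∏_{i=1}^n (a_i t + 1) − C(bt+n, n) + C(bt+n−1, n−1). -/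
open Pointwise Polynomial

/-- The box `∏_i [0, a_i]` with the corner at the origin chiseled off at distance `b`. -/
def chiseledBox (n : ℕ) (a : Fin n → ℕ) (b : ℕ) : Set (Fin n → ℝ) :=
  {x | (∀ i, 0 ≤ x i ∧ x i ≤ (a i : ℝ)) ∧ (b : ℝ) ≤ ∑ i, x i}

/-- Membership of an integer vector in a dilate of the chiseled box, in integer terms. -/
theorem intVec_mem_smul_chiseledBox {n : ℕ} (a : Fin n → ℕ) (b : ℕ) {t : ℕ} (ht : 0 < t)
    (z : Fin n → ℤ) :
    intVec z ∈ (t : ℝ) • chiseledBox n a b ↔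
      (∀ i, 0 ≤ z i ∧ z i ≤ ((a i * t : ℕ) : ℤ)) ∧ ((b * t : ℕ) : ℤ) ≤ ∑ i, z i := by
  have ht' : (0 : ℝ) < t := by exact_mod_cast ht
  rw [Set.mem_smul_set_iff_inv_smul_mem₀ ht'.ne']
  simp only [chiseledBox, intVec, Set.mem_ofPred_eq, Pi.smul_apply, smul_eq_mul, ← Finset.mul_sum]
  simp only [inv_mul_eq_div, le_div_iff₀ ht', div_le_iff₀ ht', zero_mul]
  norm_cast

/-- The lattice points of a dilate of the chiseled box correspond to the vectors of naturals in a
discrete box whose coordinate sum is large enough. -/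
theorem latticePointCount_chiseledBox {n : ℕ} (a : Fin n → ℕ) (b : ℕ) {t : ℕ} (ht : 0 < t) :
    latticePointCount (chiseledBox n a b) t =
      ((Fintype.piFinset fun i => Finset.range (a i * t + 1)).filter
        fun x => ¬ ∑ i, x i < b * t).card := by
  have hinj : Function.Injective fun (x : Fin n → ℕ) (i : Fin n) => (x i : ℤ) :=
    fun x y hxy => funext fun i => Int.ofNat_inj.mp (congrFun hxy i)
  rw [latticePointCount, ← Set.ncard_coe_finset, ← Set.ncard_image_of_injective _ hinj]
  congr 1
  ext z
  simp only [Set.mem_ofPred_eq, intVec_mem_smul_chiseledBox a b ht, Set.mem_image,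
    Finset.coe_filter, Fintype.mem_piFinset, Finset.mem_range, not_lt, Nat.lt_succ_iff]
  constructor
  · rintro ⟨hz, hs⟩
    lift z to Fin n → ℕ using fun i => (hz i).1
    beta_reduce at hz hs
    exact ⟨z, ⟨fun i => by exact_mod_cast (hz i).2, by exact_mod_cast hs⟩, rfl⟩
  · rintro ⟨x, ⟨hx, hs⟩, rfl⟩
    beta_reduce
    exact ⟨fun i => ⟨by positivity, by exact_mod_cast hx i⟩, by exact_mod_cast hs⟩

theorem card_piAntidiag_univ_fin (n k : ℕ) :
    (Finset.piAntidiag (Finset.univ : Finset (Fin n)) k).card = n.multichoose k := by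
  have h := Finset.card_finsuppAntidiag_nat_eq_multichoose (s := (Finset.univ : Finset (Fin n))) k
  rw [Finset.card_univ, Fintype.card_fin] at h
  rw [← h]
  symm
  refine Finset.card_equiv Finsupp.equivFunOnFinite fun f => ?_
  simp

/-- Once every side of a discrete box is at least `m`, the number of its points with coordinate sum
at most `m` is `C(m + n, n)`. -/
theorem card_filter_sum_le_piFinset_range {n : ℕ} (c : Fin n → ℕ) (m : ℕ) (hc : ∀ i, m ≤ c i) :
    ((Fintype.piFinset fun i => Finset.range (c i + 1)).filter fun x => ∑ i, x i ≤ m).card =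
      (m + n).choose n := by
  rw [Finset.card_eq_sum_card_fiberwise (f := fun x => ∑ i, x i) (t := Finset.range (m + 1))
    fun x hx => by simpa [Nat.lt_succ_iff] using (Finset.mem_filter.mp hx).2]
  have hfiber : ∀ k ∈ Finset.range (m + 1),
      (((Fintype.piFinset fun i => Finset.range (c i + 1)).filter fun x => ∑ i, x i ≤ m).filter
        fun x => ∑ i, x i = k).card = n.multichoose k := by
    intro k hk
    rw [← card_piAntidiag_univ_fin]
    congr 1
    ext x
    simp only [Finset.mem_filter, Fintype.mem_piFinset, Finset.mem_range, Finset.mem_piAntidiag,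
      Finset.mem_univ, implies_true, and_true, Nat.lt_succ_iff] at hk ⊢
    refine ⟨fun h => h.2, fun h => ⟨⟨fun i => ?_, h.trans_le hk⟩, h⟩⟩
    have hi : x i ≤ ∑ j, x j := Finset.single_le_sum (fun _ _ => Nat.zero_le _) (Finset.mem_univ i)
    exact (hi.trans (h.trans_le hk)).trans (hc i)
  rw [Finset.sum_congr rfl hfiber, Nat.sum_range_multichoose]

/-- For `n ≥ 1` and positive integers `a_1, …, a_n, b` with `b < a_i` for all `i`,
the number of lattice points in the `t`-th dilate of the chiseled box is
`∏_i (a_i t + 1) − C(bt+n, n) + C(bt+n−1, n−1)`. -/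
theorem ehrhart_chiseledBox (n : ℕ) (hn : 1 ≤ n) (a : Fin n → ℕ) (b : ℕ)
    (ha : ∀ i, 0 < a i) (hb : 0 < b) (hba : ∀ i, b < a i) (t : ℕ) (ht : 0 < t) :
    (latticePointCount (chiseledBox n a b) t : ℚ) =
      (∏ i, ((a i : ℚ) * t + 1)) - ((b * t + n).choose n : ℚ)
        + ((b * t + n - 1).choose (n - 1) : ℚ) := by
  have hbt : 0 < b * t := Nat.mul_pos hb ht
  obtain ⟨m, hm⟩ : ∃ m, b * t = m + 1 := ⟨b * t - 1, by omega⟩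
  obtain ⟨k, rfl⟩ : ∃ k, n = k + 1 := ⟨n - 1, by omega⟩
  have hcorner := card_filter_sum_le_piFinset_range (fun i => a i * t) m fun i => by
    have := Nat.mul_le_mul_right t (hba i).le
    omega
  have hsplit := Finset.card_filter_add_card_filter_not
    (s := Fintype.piFinset fun i => Finset.range (a i * t + 1)) fun x => ∑ i, x i < b * t
  rw [← latticePointCount_chiseledBox a b ht, hm, Fintype.card_piFinset] at hsplit
  simp only [Nat.lt_succ_iff, Finset.card_range] at hsplit
  rw [hcorner] at hsplit
  have hpascal : (m + 1 + (k + 1)).choose (k + 1) =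
      (m + 1 + k).choose k + (m + (k + 1)).choose (k + 1) := by
    rw [← add_assoc, Nat.choose_succ_succ', add_right_comm m 1 k, add_assoc m k 1]
  have hsplit' := congrArg (Nat.cast : ℕ → ℚ) hsplit
  have hpascal' := congrArg (Nat.cast : ℕ → ℚ) hpascal
  push_cast at hsplit' hpascal'
  rw [hm, show m + 1 + (k + 1) - 1 = m + 1 + k by omega, Nat.add_sub_cancel]
  linarith
end

section
/- Let P ⊂ ℝ^n be a lattice polytope, let v ∈ ℤ^n be a vertex of P, let u_1, …, u_n be a ℤ-basis of ℤ^n, let b be a positive integer, and let λ : ℝ^n → ℝ be the linear functional determined by λ(u_i) = 1 for all i. Assume that P ∩ {x : λ(x − v) ≤ b} = conv{v, v + b·u_1, …, v + b·u_n}. Let P' = P ∩ {x : λ(x − v) ≥ b}. Then for every positive integer t, |tP' ∩ ℤ^n| = |tP ∩ ℤ^n| − C(bt+n−1, n). -/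
open Pointwise Polynomial

lemma intVec_add_sum_smul {n : ℕ} (w k : Fin n → ℤ) (u : Fin n → Fin n → ℤ) :
    intVec (w + ∑ i, k i • u i) = intVec w + ∑ i, (k i : ℝ) • intVec (u i) := by
  ext j
  simp [intVec, Finset.sum_apply]

lemma IsZBasis.sum_smul_intVec_injective {n : ℕ} {u : Fin n → Fin n → ℤ} (hu : IsZBasis u) :
    Function.Injective fun c : Fin n → ℝ => ∑ i, c i • intVec (u i) := by
  have hunit : IsUnit ((Matrix.of u).map (Int.castRingHom ℝ)) := by
    rw [Matrix.isUnit_iff_isUnit_det]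
    have h := RingHom.map_det (Int.castRingHom ℝ) (Matrix.of u)
    rw [RingHom.mapMatrix_apply] at h
    rw [← h]
    exact IsUnit.map _ hu
  convert! Matrix.vecMul_injective_of_isUnit hunit using 2 with c
  rw [Matrix.vecMul_eq_sum]
  rfl

lemma IsZBasis.exists_eq_sum_smul {n : ℕ} {u : Fin n → Fin n → ℤ} (hu : IsZBasis u)
    (w : Fin n → ℤ) : ∃ k : Fin n → ℤ, w = ∑ i, k i • u i := by
  refine ⟨Matrix.vecMul w (Matrix.of u)⁻¹, ?_⟩
  have h : Matrix.vecMul (Matrix.vecMul w (Matrix.of u)⁻¹) (Matrix.of u) = w := by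
    rw [Matrix.vecMul_vecMul, Matrix.nonsing_inv_mul _ hu, Matrix.vecMul_one]
  rw [Matrix.vecMul_eq_sum] at h
  exact h.symm

lemma mem_convexHull_corner_simplex {n : ℕ} {E : Type*} [AddCommGroup E] [Module ℝ E]
    (v : E) (e : Fin n → E) {b : ℝ} (hb : 0 < b) (x : E) :
    x ∈ convexHull ℝ (insert v (Set.range fun i => v + b • e i)) ↔
      ∃ c : Fin n → ℝ, (∀ i, 0 ≤ c i) ∧ ∑ i, c i ≤ b ∧ x = v + ∑ i, c i • e i := by
  constructor
  · suffices convexHull ℝ (insert v (Set.range fun i => v + b • e i)) ⊆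
        {x | ∃ c : Fin n → ℝ, (∀ i, 0 ≤ c i) ∧ ∑ i, c i ≤ b ∧ x = v + ∑ i, c i • e i} from
      fun hx => this hx
    refine convexHull_min ?_ ?_
    · rintro y (rfl | ⟨i, rfl⟩)
      · exact ⟨0, by simp, by simpa using hb.le, by simp⟩
      · refine ⟨Pi.single i b, fun j => ?_, by simp, ?_⟩
        · by_cases h : j = i
          · subst h; simpa using hb.le
          · simp [h]
        · simp [Pi.single_apply, ite_smul]
    · rintro _ ⟨c, hc, hcb, rfl⟩ _ ⟨d, hd, hdb, rfl⟩ p q hp hq hpq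
      refine ⟨p • c + q • d, fun i => ?_, ?_, ?_⟩
      · have := hc i
        have := hd i
        simp only [Pi.add_apply, Pi.smul_apply, smul_eq_mul]
        positivity
      · simp only [Pi.add_apply, Pi.smul_apply, smul_eq_mul, Finset.sum_add_distrib,
          ← Finset.mul_sum]
        calc p * ∑ i, c i + q * ∑ i, d i ≤ p * b + q * b := by gcongr
          _ = b := by rw [← add_mul, hpq, one_mul]
      · simp only [Pi.add_apply, Pi.smul_apply, smul_eq_mul, add_smul, mul_smul,
          Finset.sum_add_distrib, ← Finset.smul_sum, smul_add]
        have hv : v = p • v + q • v := by rw [← add_smul, hpq, one_smul]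
        nth_rw 3 [hv]
        abel
  · rintro ⟨c, hc, hcb, rfl⟩
    have key := (convex_convexHull ℝ (insert v (Set.range fun i => v + b • e i))).sum_mem
      (t := Finset.univ)
      (w := fun o : Option (Fin n) => o.elim (1 - ∑ i, c i / b) fun i => c i / b)
      (z := fun o => o.elim v fun i => v + b • e i) ?_ ?_ ?_
    · convert key using 1
      simp only [Fintype.sum_option, Option.elim, smul_add, Finset.sum_add_distrib, smul_smul,
        div_mul_cancel₀ _ hb.ne', ← Finset.sum_smul]
      rw [← add_assoc, ← add_smul]
      simp
    · rintro (_ | i) -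
      · simpa [← Finset.sum_div] using div_le_one_of_le₀ hcb hb.le
      · exact div_nonneg (hc i) hb.le
    · simp [Fintype.sum_option]
    · rintro (_ | i) - <;> apply subset_convexHull
      · exact Set.mem_insert _ _
      · exact Set.mem_insert_of_mem _ ⟨i, rfl⟩

lemma ncard_setOf_sum_lt (n : ℕ) {m : ℕ} (hm : 0 < m) :
    {k : Fin n → ℕ | ∑ i, k i < m}.ncard = (m + n - 1).choose n := by
  obtain ⟨m, rfl⟩ := Nat.exists_eq_add_one.mpr hm
  have hset : {k : Fin n → ℕ | ∑ i, k i < m + 1} =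
      (((Finset.range (m + 1)).biUnion fun i =>
        (Finset.univ : Finset (Fin n)).finsuppAntidiag i).map
          Finsupp.equivFunOnFinite.toEmbedding : Finset (Fin n → ℕ)) := by
    ext k
    simp only [Set.mem_ofPred_eq, Finset.coe_map, Set.mem_image, Finset.mem_coe,
      Finset.mem_biUnion, Finset.mem_range, Finset.mem_finsuppAntidiag]
    constructor
    · exact fun hk => ⟨Finsupp.equivFunOnFinite.symm k,
        ⟨∑ i, k i, hk, by simp, Finset.subset_univ _⟩, by simp⟩
    · rintro ⟨f, ⟨i, hi, rfl, -⟩, rfl⟩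
      simpa using hi
  rw [hset, Set.ncard_coe_finset, Finset.card_map, Finset.card_biUnion]
  · simp only [Finset.card_finsuppAntidiag_nat_eq_multichoose, Finset.card_univ, Fintype.card_fin]
    rw [Nat.sum_range_multichoose]
    congr 1
    omega
  · intro i _ j _ hij
    refine Finset.disjoint_left.mpr fun f hf hf' => hij ?_
    rw [Finset.mem_finsuppAntidiag] at hf hf'
    exact hf.1.symm.trans hf'.1

lemma finite_setOf_intVec_mem {n : ℕ} {s : Set (Fin n → ℝ)} (hs : Bornology.IsBounded s) :
    {z : Fin n → ℤ | intVec z ∈ s}.Finite := by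
  obtain ⟨R, hR⟩ := hs.exists_norm_le
  refine (Set.finite_Icc (fun _ : Fin n => -⌈R⌉) fun _ => ⌈R⌉).subset fun z hz => ?_
  have h : ∀ i, |(z i : ℝ)| ≤ ⌈R⌉ := fun i =>
    (norm_le_pi_norm (intVec z) i).trans ((hR _ hz).trans (Int.le_ceil R))
  exact ⟨fun i => by exact_mod_cast (abs_le.mp (h i)).1,
    fun i => by exact_mod_cast (abs_le.mp (h i)).2⟩

lemma IsLatticePolytope.isBounded {n : ℕ} {P : Set (Fin n → ℝ)} (hP : IsLatticePolytope P) :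
    Bornology.IsBounded P := by
  obtain ⟨V, rfl⟩ := hP
  exact isBounded_convexHull.mpr (V.finite_toSet.image _).isBounded

lemma setOf_intVec_mem_smul_corner_eq_image {n : ℕ} {v : Fin n → ℤ} {u : Fin n → Fin n → ℤ}
    (hu : IsZBasis u) {lam : (Fin n → ℝ) →ₗ[ℝ] ℝ} (hlam : ∀ i, lam (intVec (u i)) = 1)
    {b t : ℕ} (hb : 0 < b) (ht : 0 < t) :
    {z : Fin n → ℤ | (t : ℝ)⁻¹ • intVec z ∈
        convexHull ℝ (insert (intVec v) (Set.range fun i => intVec v + (b : ℝ) • intVec (u i))) ∧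
        lam ((t : ℝ)⁻¹ • intVec z - intVec v) < b} =
      (fun k : Fin n → ℕ => (t : ℤ) • v + ∑ i, (k i : ℤ) • u i) ''
        {k | ∑ i, k i < b * t} := by
  have hb' : (0 : ℝ) < b := by exact_mod_cast hb
  have ht' : (0 : ℝ) < t := by exact_mod_cast ht
  have hvec : ∀ k : Fin n → ℤ, intVec ((t : ℤ) • v + ∑ i, k i • u i) =
      (t : ℝ) • intVec v + ∑ i, (k i : ℝ) • intVec (u i) := fun k => by
    rw [intVec_add_sum_smul]
    congr 1
    ext j
    simp [intVec]
  ext z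
  simp only [Set.mem_ofPred_eq, Set.mem_image, mem_convexHull_corner_simplex _ _ hb']
  constructor
  · rintro ⟨⟨c, hc, -, hz⟩, hlt⟩
    obtain ⟨k, hk⟩ := hu.exists_eq_sum_smul (z - (t : ℤ) • v)
    replace hk : z = (t : ℤ) • v + ∑ i, k i • u i := by rw [← hk]; abel
    have hcz : intVec z = (t : ℝ) • intVec v + ∑ i, (t * c i) • intVec (u i) := by
      rw [inv_smul_eq_iff₀ ht'.ne'] at hz
      simp only [hz, smul_add, Finset.smul_sum, smul_smul]
    have hkc : ∀ i, (k i : ℝ) = t * c i := congrFun <| hu.sum_smul_intVec_injective <| by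
      rw [hk, hvec] at hcz
      exact add_left_cancel hcz
    have hk0 : ∀ i, 0 ≤ k i := fun i => by
      have : (0 : ℝ) ≤ k i := hkc i ▸ mul_nonneg ht'.le (hc i)
      exact_mod_cast this
    have hkn : ∀ i, ((k i).toNat : ℤ) = k i := fun i => Int.toNat_of_nonneg (hk0 i)
    refine ⟨fun i => (k i).toNat, ?_, ?_⟩
    · rw [hz, add_sub_cancel_left] at hlt
      simp only [map_sum, map_smul, hlam, smul_eq_mul, mul_one] at hlt
      have : ((∑ i, (k i).toNat : ℕ) : ℝ) < (b * t : ℕ) := by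
        push_cast
        calc ∑ i, ((k i).toNat : ℝ) = t * ∑ i, c i := by
              rw [Finset.mul_sum]
              exact Finset.sum_congr rfl fun i _ => by rw [← hkc]; exact_mod_cast hkn i
          _ < b * t := by rw [mul_comm]; gcongr
      exact_mod_cast this
    · simp only [hkn, ← hk]
  · rintro ⟨k, hk, rfl⟩
    have hsum : ∑ i, (k i : ℝ) / t < b := by
      rw [← Finset.sum_div, div_lt_iff₀ ht']
      exact_mod_cast hk
    have hz : (t : ℝ)⁻¹ • intVec ((t : ℤ) • v + ∑ i, (k i : ℤ) • u i) =
        intVec v + ∑ i, ((k i : ℝ) / t) • intVec (u i) := by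
      rw [inv_smul_eq_iff₀ ht'.ne', hvec]
      simp only [smul_add, Finset.smul_sum, smul_smul, mul_div_cancel₀ _ ht'.ne', Int.cast_natCast]
    refine ⟨⟨fun i => k i / t, fun i => by positivity, hsum.le, hz⟩, ?_⟩
    rw [hz, add_sub_cancel_left]
    simpa [hlam] using hsum

/-- Chiseling off a vertex `v` of a lattice polytope `P` at distance `b` removes
exactly `C(bt+n−1, n)` lattice points from the `t`-th dilate: if `u 0, …, u (n-1)` is a
`ℤ`-basis, `λ` is the linear functional with `λ(u i) = 1`, and
`P ∩ {λ(x−v) ≤ b} = conv{v, v + b·u 0, …, v + b·u (n-1)}`, then for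
`P' = P ∩ {λ(x−v) ≥ b}` we have `|tP' ∩ ℤ^n| = |tP ∩ ℤ^n| − C(bt+n−1, n)`. -/
theorem ehrhart_chisel_vertex (n : ℕ) (P : Set (Fin n → ℝ)) (hP : IsLatticePolytope P)
    (v : Fin n → ℤ) (hv : intVec v ∈ Set.extremePoints ℝ P)
    (u : Fin n → Fin n → ℤ) (hu : IsZBasis u) (b : ℕ) (hb : 0 < b)
    (lam : (Fin n → ℝ) →ₗ[ℝ] ℝ) (hlam : ∀ i, lam (intVec (u i)) = 1)
    (hchisel : P ∩ {x | lam (x - intVec v) ≤ (b : ℝ)} =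
      convexHull ℝ (insert (intVec v) (Set.range fun i => intVec v + (b : ℝ) • intVec (u i))))
    (t : ℕ) (ht : 0 < t) :
    (latticePointCount (P ∩ {x | (b : ℝ) ≤ lam (x - intVec v)}) t : ℚ) =
      (latticePointCount P t : ℚ) - ((b * t + n - 1).choose n : ℚ) := by
  have ht' : (t : ℝ) ≠ 0 := by exact_mod_cast ht.ne'
  set A : Set (Fin n → ℤ) := {z | intVec z ∈ (t : ℝ) • P} with hA
  set B : Set (Fin n → ℤ) :=
    {z | intVec z ∈ (t : ℝ) • (P ∩ {x | (b : ℝ) ≤ lam (x - intVec v)})} with hB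
  have hBA : B ⊆ A := fun z hz => Set.smul_set_mono Set.inter_subset_left hz
  have hfin : A.Finite := finite_setOf_intVec_mem (hP.isBounded.smul₀ (t : ℝ))
  have hdiff : A \ B = (fun k : Fin n → ℕ => (t : ℤ) • v + ∑ i, (k i : ℤ) • u i) ''
      {k | ∑ i, k i < b * t} := by
    rw [← setOf_intVec_mem_smul_corner_eq_image hu hlam hb ht, ← hchisel]
    ext z
    simp only [hA, hB, Set.mem_sdiff, Set.mem_ofPred_eq, Set.mem_inter_iff,
      Set.mem_smul_set_iff_inv_smul_mem₀ ht', not_and, not_le]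
    exact ⟨fun h => ⟨⟨h.1, (h.2 h.1).le⟩, h.2 h.1⟩, fun h => ⟨h.1.1, fun _ => h.2⟩⟩
  have hinj : Function.Injective
      fun k : Fin n → ℕ => (t : ℤ) • v + ∑ i, (k i : ℤ) • u i := fun k l hkl => by
    have h := congrArg intVec hkl
    simp only [intVec_add_sum_smul] at h
    funext i
    exact_mod_cast congrFun (hu.sum_smul_intVec_injective (add_left_cancel h)) i
  have hcount : (A \ B).ncard = (b * t + n - 1).choose n := by
    rw [hdiff, Set.ncard_image_of_injective _ hinj, ncard_setOf_sum_lt n (Nat.mul_pos hb ht)]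
  have hadd := Set.ncard_sdiff_add_ncard_of_subset hBA hfin
  rw [hcount] at hadd
  change (B.ncard : ℚ) = (A.ncard : ℚ) - _
  rw [← hadd]
  push_cast
  ring
end

section
/- For every integer k ≥ 1, the following identity of polynomials in t over ℚ holds: (3^k t + 1)^3 − Σ_{j=0}^{k−1} 8·3^j · (3^{k−1−j}t + 2)(3^{k−1−j}t + 1)(3^{k−1−j}t)/6 = (1/2)·3^{k−2}(17·3^{2k} + 1)·t^3 + 3^{k−1}(7·3^k + 2)·t^2 − 3^{k−2}(8k − 27)·t + 1. -/
open Polynomial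

/-- The number of lattice points removed by the iterated chiseling, in closed form. -/
theorem sum_chiseled_vertices (n : ℕ) (t : ℚ) :
    ∑ j ∈ Finset.range (n + 1),
      (8 * 3 ^ j : ℚ) / 6 *
        ((3 ^ (n - j) * t + 2) * (3 ^ (n - j) * t + 1) * (3 ^ (n - j) * t))
    = 3 ^ n * ((9 * (3 ^ n) ^ 2 - 1) / 6 * t ^ 3 + 2 * (3 * 3 ^ n - 1) * t ^ 2
        + 8 / 3 * (n + 1) * t) := by
  induction n with
  | zero => simp; ring
  | succ n ih =>
    have hstep : ∑ j ∈ Finset.range (n + 1), (8 * 3 ^ (j + 1) : ℚ) / 6 *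
          ((3 ^ (n - j) * t + 2) * (3 ^ (n - j) * t + 1) * (3 ^ (n - j) * t))
        = 3 * ∑ j ∈ Finset.range (n + 1), (8 * 3 ^ j : ℚ) / 6 *
          ((3 ^ (n - j) * t + 2) * (3 ^ (n - j) * t + 1) * (3 ^ (n - j) * t)) := by
      rw [Finset.mul_sum]
      exact Finset.sum_congr rfl fun j _ => by ring
    rw [Finset.sum_range_succ']
    simp only [Nat.add_sub_add_right, Nat.sub_zero]
    rw [hstep, ih]
    push_cast
    ring

/-- The Ehrhart polynomial of the iteratively chiseled cube `B_k`: for `k ≥ 1`,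
`(3^k t + 1)^3 − ∑_{j=0}^{k−1} 8·3^j·(3^{k−1−j}t+2)(3^{k−1−j}t+1)(3^{k−1−j}t)/6`
equals `(1/2)·3^{k−2}(17·3^{2k}+1)·t^3 + 3^{k−1}(7·3^k+2)·t^2 − 3^{k−2}(8k−27)·t + 1`
as polynomials in `t` over `ℚ`. -/
theorem ehrhart_iterated_chiseled_cube (k : ℕ) (hk : 1 ≤ k) :
    (C ((3 : ℚ) ^ k) * X + 1) ^ 3
      - ∑ j ∈ Finset.range k,
          C ((8 * 3 ^ j : ℚ) / 6) *
            ((C ((3 : ℚ) ^ (k - 1 - j)) * X + 2) * (C ((3 : ℚ) ^ (k - 1 - j)) * X + 1) *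
              (C ((3 : ℚ) ^ (k - 1 - j)) * X))
    = C ((1 / 2) * (3 : ℚ) ^ ((k : ℤ) - 2) * (17 * 3 ^ (2 * k) + 1)) * X ^ 3
        + C ((3 : ℚ) ^ (k - 1) * (7 * 3 ^ k + 2)) * X ^ 2
        - C ((3 : ℚ) ^ ((k : ℤ) - 2) * (8 * (k : ℚ) - 27)) * X + 1 := by
  obtain ⟨n, rfl⟩ : ∃ n, k = n + 1 := ⟨k - 1, by omega⟩
  have hz : (3 : ℚ) ^ (((n + 1 : ℕ) : ℤ) - 2) = 3 ^ n / 3 := by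
    rw [show ((n + 1 : ℕ) : ℤ) - 2 = (n : ℤ) - 1 by push_cast; ring,
      zpow_sub_one₀ (by norm_num), zpow_natCast, div_eq_mul_inv]
  refine Polynomial.funext fun t => ?_
  simp only [eval_add, eval_sub, eval_mul, eval_pow, eval_C, eval_X, eval_one, eval_ofNat,
    eval_finsetSum, hz, Nat.add_sub_cancel]
  rw [sum_chiseled_vertices]
  push_cast
  ring
end

section
/- For every integer n ≥ 1 there exists an integer K such that for all k ≥ K the following holds. Set a = ⌊7k·3^{k−2}/n⌋, q_1 = 3^{k−2}(8k − 27), q_2 = 3^{k−1}(7·3^k + 2), q_3 = (1/2)·3^{k−2}(17·3^{2k} + 1). Then in the polynomial (q_3 t^3 + q_2 t^2 − q_1 t + 1)·(a t + 1)^n ∈ ℚ[t], the coefficient of t^j is strictly negative for every j = 1, …, n+1, while the coefficients of t^0, t^{n+2} and t^{n+3} are strictly positive. -/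
open Polynomial

theorem coeff_C_mul_X_add_one_pow_s7 (a : ℚ) (n m : ℕ) :
    ((C a * X + 1) ^ n : ℚ[X]).coeff m = n.choose m * a ^ m := by
  have h : ((C a * X + 1) ^ n : ℚ[X]) = ((X + 1) ^ n : ℚ[X]).comp (C a * X) := by simp
  rw [h, comp_C_mul_X_coeff, coeff_X_add_one_pow]

theorem choose_mul_pow_succ_le {a : ℚ} (ha : 0 ≤ a) (n m : ℕ) :
    (n.choose (m + 1) : ℚ) * a ^ (m + 1) ≤ n * a * (n.choose m * a ^ m) := by
  have h : n.choose (m + 1) ≤ n.choose m * n :=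
    calc n.choose (m + 1) ≤ n.choose (m + 1) * (m + 1) := Nat.le_mul_of_pos_right _ m.succ_pos
      _ = n.choose m * (n - m) := Nat.choose_succ_right_eq n m
      _ ≤ n.choose m * n := Nat.mul_le_mul_left _ (Nat.sub_le n m)
  have h' : (n.choose (m + 1) : ℚ) ≤ n.choose m * n := mod_cast h
  calc (n.choose (m + 1) : ℚ) * a ^ (m + 1) ≤ (n.choose m * n) * a ^ (m + 1) := by gcongr
    _ = n * a * (n.choose m * a ^ m) := by ring

theorem choose_mul_pow_mul_pow_le {a x : ℚ} (hx : 0 ≤ x) (hxa : x ≤ a) {n m d : ℕ}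
    (h : m + d ≤ n) :
    (n.choose m : ℚ) * a ^ m * x ^ d ≤ 2 ^ n * (n.choose (m + d) * a ^ (m + d)) := by
  have h₁ : (n.choose m : ℚ) ≤ 2 ^ n := mod_cast Nat.choose_le_two_pow n m
  have h₂ : (1 : ℚ) ≤ n.choose (m + d) := mod_cast Nat.choose_pos h
  have ha : 0 ≤ a := hx.trans hxa
  calc (n.choose m : ℚ) * a ^ m * x ^ d ≤ 2 ^ n * a ^ m * a ^ d := by gcongr
    _ = 2 ^ n * (1 * a ^ (m + d)) := by ring
    _ ≤ 2 ^ n * (n.choose (m + d) * a ^ (m + d)) := by gcongr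

theorem product_polynomial_coeff_zero (q1 q2 q3 : ℚ) (f : ℚ[X]) :
    ((C q3 * X ^ 3 + C q2 * X ^ 2 - C q1 * X + 1) * f).coeff 0 = f.coeff 0 := by
  simp [mul_coeff_zero]

theorem product_polynomial_coeff_one (q1 q2 q3 : ℚ) (f : ℚ[X]) :
    ((C q3 * X ^ 3 + C q2 * X ^ 2 - C q1 * X + 1) * f).coeff 1 =
      -(q1 * f.coeff 0) + f.coeff 1 := by
  rw [← pow_one (X : ℚ[X]), ← pow_mul, ← pow_mul]
  simp [-pow_one, add_mul, sub_mul, mul_assoc, coeff_X_pow_mul']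

theorem product_polynomial_coeff_two (q1 q2 q3 : ℚ) (f : ℚ[X]) :
    ((C q3 * X ^ 3 + C q2 * X ^ 2 - C q1 * X + 1) * f).coeff 2 =
      q2 * f.coeff 0 - q1 * f.coeff 1 + f.coeff 2 := by
  rw [← pow_one (X : ℚ[X]), ← pow_mul, ← pow_mul]
  simp [-pow_one, add_mul, sub_mul, mul_assoc, coeff_X_pow_mul']

theorem product_polynomial_coeff_add_three (q1 q2 q3 : ℚ) (f : ℚ[X]) (m : ℕ) :
    ((C q3 * X ^ 3 + C q2 * X ^ 2 - C q1 * X + 1) * f).coeff (m + 3) =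
      q3 * f.coeff m + q2 * f.coeff (m + 1) - q1 * f.coeff (m + 2) + f.coeff (m + 3) := by
  rw [← pow_one (X : ℚ[X]), ← pow_mul, ← pow_mul]
  simp [-pow_one, add_mul, sub_mul, mul_assoc, coeff_X_pow_mul']

/-- For every `n ≥ 1`, for all sufficiently large `k`, taking `a = ⌊7k·3^{k−2}/n⌋` and
the Ehrhart coefficients `q₁, q₂, q₃` of the iteratively chiseled cube `B_k`, the
polynomial `(q₃t³ + q₂t² − q₁t + 1)(at+1)^n` has strictly negative coefficients of
`t^j` for all `j = 1, …, n+1`, while the coefficients of `t^0`, `t^{n+2}`, `t^{n+3}`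
are strictly positive. -/
theorem product_polynomial_negative_coeffs (n : ℕ) (hn : 1 ≤ n) :
    ∃ K : ℕ, ∀ k : ℕ, K ≤ k →
      let a : ℕ := 7 * k * 3 ^ (k - 2) / n
      let q1 : ℚ := (3 : ℚ) ^ (k - 2) * (8 * (k : ℚ) - 27)
      let q2 : ℚ := (3 : ℚ) ^ (k - 1) * (7 * 3 ^ k + 2)
      let q3 : ℚ := (1 / 2) * (3 : ℚ) ^ (k - 2) * (17 * 3 ^ (2 * k) + 1)
      let p : Polynomial ℚ :=
        (C q3 * X ^ 3 + C q2 * X ^ 2 - C q1 * X + 1) * (C (a : ℚ) * X + 1) ^ n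
      (∀ j : ℕ, 1 ≤ j → j ≤ n + 1 → p.coeff j < 0) ∧
        0 < p.coeff 0 ∧ 0 < p.coeff (n + 2) ∧ 0 < p.coeff (n + 3) := by
  refine ⟨28 + n + 1000 * 2 ^ n, fun k hk => ?_⟩
  intro a q1 q2 q3 p
  obtain ⟨l, rfl⟩ : ∃ l, k = l + 2 := ⟨k - 2, by omega⟩
  set k : ℕ := l + 2 with hkl
  set x : ℚ := 3 ^ l with hx
  have hx1 : 1 ≤ x := one_le_pow₀ (by norm_num)
  have hq1 : q1 = x * (8 * k - 27) := by simp [q1, hx, hkl]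
  have hq2 : q2 = 3 * x * (63 * x + 2) := by
    simp only [q2, hx, show l + 2 - 1 = l + 1 from rfl]; ring
  have hq3 : q3 = 1 / 2 * x * (1377 * x ^ 2 + 1) := by
    simp only [q3, hx, Nat.add_sub_cancel]; ring
  have hq2pos : 0 < q2 := by rw [hq2]; positivity
  have hq3pos : 0 < q3 := by rw [hq3]; positivity
  have hq2le : q2 ≤ 195 * x * x := by rw [hq2]; nlinarith
  have hq3le : q3 ≤ 689 * x * x ^ 2 := by
    rw [hq3]; nlinarith [mul_pos (zero_lt_one.trans_le hx1) (zero_lt_one.trans_le hx1)]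
  have hna : (n : ℚ) * a ≤ 7 * k * x := by
    have h : n * a ≤ 7 * k * 3 ^ l := Nat.mul_div_le _ _
    rw [hx]; exact_mod_cast h
  have hxa : x ≤ a := by
    have h : 3 ^ l ≤ a := by
      refine (Nat.le_div_iff_mul_le hn).2 ?_
      rw [mul_comm]
      exact Nat.mul_le_mul_right _ (by omega)
    rw [hx]; exact_mod_cast h
  have ha : (0 : ℚ) < a := by linarith
  have hkQ : (28 : ℚ) + n + 1000 * 2 ^ n ≤ k := mod_cast hk
  have hnQ : (0 : ℚ) ≤ n := n.cast_nonneg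
  set c : ℕ → ℚ := fun m => n.choose m * (a : ℚ) ^ m with hc
  have hcoeff (m : ℕ) : ((C (a : ℚ) * X + 1) ^ n : ℚ[X]).coeff m = c m :=
    coeff_C_mul_X_add_one_pow_s7 _ _ _
  have hc0 (m : ℕ) : 0 ≤ c m := by positivity
  have hcpos {m : ℕ} (hm : m ≤ n) : 0 < c m := by
    have := Nat.choose_pos hm
    positivity
  have hsucc (m : ℕ) : c (m + 1) ≤ 7 * k * x * c m :=
    (choose_mul_pow_succ_le ha.le n m).trans (mul_le_mul_of_nonneg_right hna (hc0 m))
  have hq2c {m : ℕ} (hm : m + 1 ≤ n) : q2 * c m ≤ 195 * 2 ^ n * (x * c (m + 1)) := by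
    have h := choose_mul_pow_mul_pow_le (by linarith) hxa hm
    rw [pow_one] at h
    calc q2 * c m ≤ 195 * x * x * c m := mul_le_mul_of_nonneg_right hq2le (hc0 m)
      _ = 195 * x * (c m * x) := by ring
      _ ≤ 195 * x * (2 ^ n * c (m + 1)) := by gcongr
      _ = _ := by ring
  have hq3c {m : ℕ} (hm : m + 2 ≤ n) : q3 * c m ≤ 689 * 2 ^ n * (x * c (m + 2)) := by
    have h := choose_mul_pow_mul_pow_le (by linarith) hxa hm
    calc q3 * c m ≤ 689 * x * x ^ 2 * c m := mul_le_mul_of_nonneg_right hq3le (hc0 m)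
      _ = 689 * x * (c m * x ^ 2) := by ring
      _ ≤ 689 * x * (2 ^ n * c (m + 2)) := by gcongr
      _ = _ := by ring
  have hdom {m : ℕ} (hm : m ≤ n) :
      884 * 2 ^ n * (x * c m) - q1 * c m + c (m + 1) < 0 := by
    have hxc : 0 < x * c m := mul_pos (by linarith) (hcpos hm)
    have h2 : (0 : ℚ) < 2 ^ n := by positivity
    have h : 0 < (k - 27 - 884 * 2 ^ n : ℚ) * (x * c m) := mul_pos (by linarith) hxc
    rw [hq1]
    linarith [hsucc m]
  have hnonneg (m : ℕ) : 0 ≤ 2 ^ n * (x * c m) :=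
    mul_nonneg (by positivity) (mul_nonneg (by linarith) (hc0 m))
  have hvanish {m : ℕ} (hm : n < m) : c m = 0 := by simp [hc, Nat.choose_eq_zero_of_lt hm]
  refine ⟨fun j hj hjn => ?_, ?_, ?_, ?_⟩
  · match j, hj with
    | 1, _ =>
      rw [product_polynomial_coeff_one, hcoeff, hcoeff]
      have h : 884 * 2 ^ n * (x * c 0) - q1 * c 0 + c 1 < 0 := hdom n.zero_le
      linarith [hnonneg 0]
    | 2, _ =>
      rw [product_polynomial_coeff_two, hcoeff, hcoeff, hcoeff]
      have h : 884 * 2 ^ n * (x * c 1) - q1 * c 1 + c 2 < 0 := hdom hn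
      have h' : q2 * c 0 ≤ 195 * 2 ^ n * (x * c 1) := hq2c hn
      linarith [hnonneg 1]
    | m + 3, _ =>
      have hm : m + 2 ≤ n := by omega
      rw [product_polynomial_coeff_add_three, hcoeff, hcoeff, hcoeff, hcoeff]
      linarith [hdom hm, hq2c (m := m + 1) hm, hq3c hm]
  · rw [product_polynomial_coeff_zero, hcoeff]
    exact hcpos n.zero_le
  · obtain ⟨m, rfl⟩ : ∃ m, n = m + 1 := ⟨n - 1, by omega⟩
    rw [show m + 1 + 2 = m + 3 from rfl, product_polynomial_coeff_add_three, hcoeff, hcoeff,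
      hcoeff, hcoeff, hvanish (m := m + 2) (by omega), hvanish (m := m + 3) (by omega)]
    have h₁ := mul_pos hq3pos (hcpos (m := m) (by omega))
    have h₂ := mul_pos hq2pos (hcpos (m := m + 1) le_rfl)
    linarith
  · rw [product_polynomial_coeff_add_three, hcoeff, hcoeff, hcoeff, hcoeff,
      hvanish (m := n + 1) (by omega), hvanish (m := n + 2) (by omega),
      hvanish (m := n + 3) (by omega)]
    have h := mul_pos hq3pos (hcpos le_rfl)
    linarith
end

section
/- For all integers 1 ≤ k ≤ n, Σ_{S ⊆ {1, …, n−1}, |S| = k−1} ∏_{s ∈ S} (1/s) ≤ (k^2/n) · C(n, k) / k!, where the sum ranges over all (k−1)-element subsets S of {1, …, n−1} (for k = 1 the only subset is the empty set, contributing 1). -/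
/-- The `j`-th elementary symmetric function of `1, 1/2, …, 1/m` is at most `C(m, j) / j!`. -/
theorem sum_powersetCard_Icc_inv_prod_le (m j : ℕ) :
    ∑ S ∈ Finset.powersetCard j (Finset.Icc 1 m), ∏ s ∈ S, ((s : ℚ))⁻¹
      ≤ (m.choose j : ℚ) / (j.factorial : ℚ) := by
  induction m generalizing j with
  | zero =>
    cases j with
    | zero => simp
    | succ j => rw [Finset.powersetCard_eq_empty.2 (by simp)]; simp
  | succ m ih =>
    cases j with
    | zero => simp
    | succ j =>
      have hnot : m + 1 ∉ Finset.Icc 1 m := by simp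
      have hmem : ∀ S ∈ Finset.powersetCard j (Finset.Icc 1 m), m + 1 ∉ S := fun S hS h =>
        hnot ((Finset.mem_powersetCard.1 hS).1 h)
      rw [← Finset.insert_Icc_right_eq_Icc_add_one (by omega : 1 ≤ m + 1),
        Finset.powersetCard_succ_insert hnot, Finset.sum_union, Finset.sum_image]
      · have hsum : ∑ S ∈ Finset.powersetCard j (Finset.Icc 1 m),
            ∏ s ∈ insert (m + 1) S, ((s : ℚ))⁻¹
            = ((m + 1 : ℕ) : ℚ)⁻¹ *
              ∑ S ∈ Finset.powersetCard j (Finset.Icc 1 m), ∏ s ∈ S, ((s : ℚ))⁻¹ := by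
          rw [Finset.mul_sum]
          exact Finset.sum_congr rfl fun S hS => Finset.prod_insert (hmem S hS)
        have hstep : ((m + 1 : ℕ) : ℚ)⁻¹ * ((m.choose j : ℚ) / (j.factorial : ℚ))
            ≤ (m.choose j : ℚ) / ((j + 1).factorial : ℚ) := by
          rcases lt_or_ge m j with h | h
          · simp [Nat.choose_eq_zero_of_lt h]
          · have hinv : ((m + 1 : ℕ) : ℚ)⁻¹ ≤ ((j + 1 : ℕ) : ℚ)⁻¹ := by gcongr
            calc _ ≤ ((j + 1 : ℕ) : ℚ)⁻¹ * ((m.choose j : ℚ) / (j.factorial : ℚ)) := by gcongr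
              _ = _ := by
                rw [Nat.factorial_succ]
                push_cast
                field_simp
        calc _ ≤ (m.choose (j + 1) : ℚ) / ((j + 1).factorial : ℚ)
              + ((m + 1 : ℕ) : ℚ)⁻¹ * ((m.choose j : ℚ) / (j.factorial : ℚ)) := by
              rw [hsum]
              gcongr
              · exact ih (j + 1)
              · exact ih j
          _ ≤ (m.choose (j + 1) : ℚ) / ((j + 1).factorial : ℚ)
              + (m.choose j : ℚ) / ((j + 1).factorial : ℚ) := by gcongr
          _ = _ := by
              rw [Nat.choose_succ_succ' m j]
              push_cast
              ring
      · intro S hS T hT h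
        rw [← Finset.erase_insert (hmem S hS), ← Finset.erase_insert (hmem T hT)]
        exact congrArg (fun U => Finset.erase U (m + 1)) h
      · rw [Finset.disjoint_left]
        intro S hS hS'
        obtain ⟨T, -, rfl⟩ := Finset.mem_image.1 hS'
        exact hnot ((Finset.mem_powersetCard.1 hS).1 (Finset.mem_insert_self _ _))

/-- For all integers `1 ≤ k ≤ n`,
`∑_{S ⊆ {1,…,n−1}, |S| = k−1} ∏_{s ∈ S} 1/s ≤ (k²/n) · C(n,k) / k!`. -/
theorem sum_subsets_inv_prod_le (n k : ℕ) (hk : 1 ≤ k) (hkn : k ≤ n) :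
    ∑ S ∈ Finset.powersetCard (k - 1) (Finset.Icc 1 (n - 1)), ∏ s ∈ S, ((s : ℚ))⁻¹
      ≤ ((k : ℚ) ^ 2 / n) * (n.choose k) / (k.factorial : ℚ) := by
  obtain ⟨j, rfl⟩ := Nat.exists_eq_add_of_le' hk
  obtain ⟨m, rfl⟩ := Nat.exists_eq_add_of_le' (hk.trans hkn)
  refine (sum_powersetCard_Icc_inv_prod_le m j).trans_eq ?_
  have h : ((m : ℚ) + 1) * m.choose j = (m + 1).choose (j + 1) * ((j : ℚ) + 1) := by
    exact_mod_cast Nat.add_one_mul_choose_eq m j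
  have hf : (j.factorial : ℚ) ≠ 0 := by positivity
  rw [Nat.factorial_succ]
  push_cast
  field_simp
  linear_combination h
end

section
/- Let n ≥ 1, let a_1, …, a_n be positive integers and, for each ε ∈ {0,1}^n, let b_ε be a positive integer, such that b_ε + b_{ε'} < a_i whenever ε, ε' ∈ {0,1}^n differ exactly in the i-th coordinate. Let P = {x ∈ ℝ^n : 0 ≤ x_i ≤ a_i for all i, and for every ε ∈ {0,1}^n, Σ_{i=1}^n (ε_i(a_i − x_i) + (1 − ε_i)x_i) ≥ b_ε}. Then for every positive integer t, |tP ∩ ℤ^n| = ∏_{i=1}^n (a_i t + 1) − Σ_{ε ∈ {0,1}^n} C(b_ε t + n − 1, n). -/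
open Pointwise Polynomial

/-- The box `∏_i [0, a_i]` with each vertex `(ε_1 a_1, …, ε_n a_n)` chiseled off at
lattice distance `b ε`. -/
def genChiseledBox (n : ℕ) (a : Fin n → ℕ) (b : (Fin n → Bool) → ℕ) :
    Set (Fin n → ℝ) :=
  {x | (∀ i, 0 ≤ x i ∧ x i ≤ (a i : ℝ)) ∧
    ∀ ε : Fin n → Bool, (b ε : ℝ) ≤ ∑ i, if ε i then (a i : ℝ) - x i else x i}

/-- The distance of `z` from the facet of `∏ i, [0, A i]` through the vertex `ε` in
direction `i`. -/
def facetDist {n : ℕ} (A : Fin n → ℤ) (ε : Fin n → Bool) (z : Fin n → ℤ) (i : Fin n) : ℤ :=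
  if ε i then A i - z i else z i

/-- The lattice points of the box `∏ i, [0, A i]`. -/
noncomputable def latticeBox {n : ℕ} (A : Fin n → ℤ) : Finset (Fin n → ℤ) :=
  Fintype.piFinset fun i => Finset.Icc 0 (A i)

/-- The lattice points of the box at distance less than `m` from the vertex `ε`. -/
noncomputable def latticeCorner {n : ℕ} (A : Fin n → ℤ) (ε : Fin n → Bool) (m : ℤ) :
    Finset (Fin n → ℤ) :=
  (latticeBox A).filter fun z => ∑ i, facetDist A ε z i < m

theorem mem_latticeBox {n : ℕ} {A : Fin n → ℤ} {z : Fin n → ℤ} :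
    z ∈ latticeBox A ↔ ∀ i, 0 ≤ z i ∧ z i ≤ A i := by
  simp [latticeBox]

theorem mem_latticeCorner {n : ℕ} {A : Fin n → ℤ} {ε : Fin n → Bool} {m : ℤ}
    {z : Fin n → ℤ} :
    z ∈ latticeCorner A ε m ↔
      (∀ i, 0 ≤ z i ∧ z i ≤ A i) ∧ ∑ i, facetDist A ε z i < m := by
  simp [latticeCorner, mem_latticeBox]

theorem facetDist_nonneg {n : ℕ} {A : Fin n → ℤ} {z : Fin n → ℤ}
    (hz : ∀ i, 0 ≤ z i ∧ z i ≤ A i) (ε : Fin n → Bool) (i : Fin n) :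
    0 ≤ facetDist A ε z i := by
  have := hz i
  unfold facetDist
  split_ifs <;> omega

theorem facetDist_add_of_ne {n : ℕ} (A : Fin n → ℤ) {ε δ : Fin n → Bool}
    (z : Fin n → ℤ) {i : Fin n} (h : ε i ≠ δ i) :
    facetDist A ε z i + facetDist A δ z i = A i := by
  unfold facetDist
  cases hε : ε i <;> cases hδ : δ i <;> simp_all

theorem card_latticeBox {n : ℕ} (A : Fin n → ℕ) :
    (latticeBox fun i => (A i : ℤ)).card = ∏ i, (A i + 1) := by
  simp only [latticeBox, Fintype.card_piFinset, Int.card_Icc]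
  exact Finset.prod_congr rfl fun i _ => by omega

theorem card_latticeCorner {n : ℕ} (A : Fin n → ℤ) (ε : Fin n → Bool) (m : ℕ)
    (hm : 0 < m) (hA : ∀ i, (m : ℤ) ≤ A i) :
    (latticeCorner A ε m).card = (m + n - 1).choose n := by
  have hcard : (Finset.univ.piAntidiag (m - 1) : Finset (Fin (n + 1) → ℕ)).card =
      (m + n - 1).choose n := by
    rw [← Finset.map_sym_eq_piAntidiag, Finset.card_map, Finset.sym_univ, Finset.card_univ,
      Sym.card_sym_eq_choose, Fintype.card_fin,
      show n + 1 + (m - 1) - 1 = m + n - 1 by omega]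
    exact Nat.choose_symm_of_eq_add (by omega)
  rw [← hcard]
  symm
  refine Finset.card_bij
    (fun y _ i => if ε i then A i - (y i.succ : ℤ) else (y i.succ : ℤ)) ?_ ?_ ?_
  · intro y hy
    rw [Finset.mem_piAntidiag, Fin.sum_univ_succ] at hy
    have hsum := hy.1
    rw [mem_latticeCorner]
    constructor
    · intro i
      have h1 : y i.succ ≤ ∑ j : Fin n, y j.succ :=
        Finset.single_le_sum (f := fun j : Fin n => y j.succ)
          (fun _ _ => Nat.zero_le _) (Finset.mem_univ i)
      have h2 := hA i
      split_ifs <;> omega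
    · have h : ∀ i, facetDist A ε
          (fun i => if ε i then A i - (y i.succ : ℤ) else (y i.succ : ℤ)) i =
            (y i.succ : ℤ) := by
        intro i
        unfold facetDist
        dsimp only
        split_ifs <;> ring
      rw [Finset.sum_congr rfl fun i _ => h i, ← Nat.cast_sum]
      omega
  · intro y hy y' hy' h
    rw [Finset.mem_piAntidiag, Fin.sum_univ_succ] at hy hy'
    have hs : ∀ i : Fin n, y i.succ = y' i.succ := by
      intro i
      have := congrFun h i
      split_ifs at this <;> omega
    have h0 := hy.1.trans hy'.1.symm
    rw [Finset.sum_congr rfl fun i _ => hs i] at h0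
    funext i
    refine Fin.cases ?_ hs i
    omega
  · intro z hz
    rw [mem_latticeCorner] at hz
    have hd := facetDist_nonneg hz.1 ε
    have hcast : ((∑ i, (facetDist A ε z i).toNat : ℕ) : ℤ) = ∑ i, facetDist A ε z i := by
      rw [Nat.cast_sum]
      exact Finset.sum_congr rfl fun i _ => Int.toNat_of_nonneg (hd i)
    refine ⟨Fin.cons (m - 1 - ∑ i, (facetDist A ε z i).toNat)
      fun i => (facetDist A ε z i).toNat, ?_, ?_⟩
    · rw [Finset.mem_piAntidiag, Fin.sum_univ_succ]
      simp only [Fin.cons_zero, Fin.cons_succ, Finset.mem_univ, implies_true, and_true]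
      have := hz.2
      omega
    · funext i
      simp only [Fin.cons_succ, Int.toNat_of_nonneg (hd i)]
      unfold facetDist
      split_ifs <;> ring

theorem disjoint_latticeCorner {n : ℕ} (A : Fin n → ℤ) (B : (Fin n → Bool) → ℤ)
    (hB : ∀ ε, 0 ≤ B ε)
    (hBA : ∀ (ε : Fin n → Bool) (i : Fin n), B ε + B (Function.update ε i (!ε i)) ≤ A i)
    {ε δ : Fin n → Bool} (hne : ε ≠ δ) :
    Disjoint (latticeCorner A ε (B ε)) (latticeCorner A δ (B δ)) := by
  rw [Finset.disjoint_left]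
  intro z hz hz'
  rw [mem_latticeCorner] at hz hz'
  have hnn : ∀ i, 0 ≤ facetDist A ε z i + facetDist A δ z i := fun i =>
    add_nonneg (facetDist_nonneg hz.1 ε i) (facetDist_nonneg hz.1 δ i)
  have hlt : ∑ i, (facetDist A ε z i + facetDist A δ z i) < B ε + B δ := by
    rw [Finset.sum_add_distrib]
    exact add_lt_add hz.2 hz'.2
  obtain ⟨i, hi⟩ := Function.ne_iff.mp hne
  by_cases h : ∃ j, j ≠ i ∧ ε j ≠ δ j
  · obtain ⟨j, hji, hj⟩ := h
    have hle := Finset.add_le_sum (fun k _ => hnn k) (Finset.mem_univ i)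
      (Finset.mem_univ j) hji.symm
    rw [facetDist_add_of_ne A z hi, facetDist_add_of_ne A z hj] at hle
    have h1 := hBA ε i
    have h2 := hB (Function.update ε i (!ε i))
    have h3 := hBA δ j
    have h4 := hB (Function.update δ j (!δ j))
    omega
  · push Not at h
    have hδ : δ = Function.update ε i (!ε i) := by
      funext j
      by_cases hj : j = i
      · subst hj
        rw [Function.update_self]
        cases hε : ε j <;> cases hδ : δ j <;> simp_all
      · rw [Function.update_of_ne hj, h j hj]
    have hle := Finset.single_le_sum (fun k _ => hnn k) (Finset.mem_univ i)
    rw [facetDist_add_of_ne A z hi] at hle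
    have h1 := hBA ε i
    rw [← hδ] at h1
    omega

theorem intVec_mem_smul_genChiseledBox_iff {n : ℕ} (a : Fin n → ℕ)
    (b : (Fin n → Bool) → ℕ) {t : ℕ} (ht : 0 < t) (z : Fin n → ℤ) :
    intVec z ∈ (t : ℝ) • genChiseledBox n a b ↔
      (∀ i, 0 ≤ z i ∧ z i ≤ ((a i * t : ℕ) : ℤ)) ∧
        ∀ ε, ((b ε * t : ℕ) : ℤ) ≤
          ∑ i, facetDist (fun i => ((a i * t : ℕ) : ℤ)) ε z i := by
  have ht' : (0 : ℝ) < t := by exact_mod_cast ht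
  rw [Set.mem_smul_set_iff_inv_smul_mem₀ ht'.ne']
  simp only [genChiseledBox, Set.mem_ofPred_eq, Pi.smul_apply, smul_eq_mul, intVec]
  refine and_congr (forall_congr' fun i => and_congr ?_ ?_) (forall_congr' fun ε => ?_)
  · rw [mul_nonneg_iff_of_pos_left (inv_pos.mpr ht')]
    exact Int.cast_nonneg_iff
  · rw [inv_mul_le_iff₀ ht', mul_comm (t : ℝ), ← Int.cast_le (R := ℝ)]
    push_cast
    rfl
  · have hsum : (∑ i, if ε i then (a i : ℝ) - (t : ℝ)⁻¹ * z i else (t : ℝ)⁻¹ * z i) =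
        (t : ℝ)⁻¹ * ((∑ i, facetDist (fun i => ((a i * t : ℕ) : ℤ)) ε z i : ℤ) : ℝ) := by
      rw [Int.cast_sum, Finset.mul_sum]
      refine Finset.sum_congr rfl fun i _ => ?_
      unfold facetDist
      split_ifs
      · push_cast
        field_simp
      · rfl
    rw [hsum, le_inv_mul_iff₀ ht', mul_comm (t : ℝ), ← Int.cast_le (R := ℝ)]
    push_cast
    rfl

/-- For `n ≥ 1`, the number of lattice points in the `t`-th dilate of the box
`∏_i [0,a_i]` with each vertex `ε` chiseled off at distance `b ε` (with
`b ε + b ε' < a i` whenever `ε, ε'` differ exactly in coordinate `i`) is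
`∏_i (a_i t + 1) − ∑_ε C(b_ε t + n − 1, n)`. -/
theorem ehrhart_genChiseledBox (n : ℕ) (hn : 1 ≤ n)
    (a : Fin n → ℕ) (ha : ∀ i, 0 < a i) (b : (Fin n → Bool) → ℕ) (hb : ∀ ε, 0 < b ε)
    (hba : ∀ (ε : Fin n → Bool) (i : Fin n),
      b ε + b (Function.update ε i (!ε i)) < a i)
    (t : ℕ) (ht : 0 < t) :
    (latticePointCount (genChiseledBox n a b) t : ℚ) =
      (∏ i, ((a i : ℚ) * t + 1)) -
        ∑ ε : Fin n → Bool, ((b ε * t + n - 1).choose n : ℚ) := by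
  classical
  set A : Fin n → ℤ := fun i => ((a i * t : ℕ) : ℤ) with hA
  set B : (Fin n → Bool) → ℤ := fun ε => ((b ε * t : ℕ) : ℤ) with hB
  set U := Finset.univ.biUnion fun ε => latticeCorner A ε (B ε) with hU
  have hset : {z : Fin n → ℤ | intVec z ∈ (t : ℝ) • genChiseledBox n a b} =
      ((latticeBox A \ U : Finset (Fin n → ℤ)) : Set (Fin n → ℤ)) := by
    ext z
    rw [Set.mem_ofPred_eq, intVec_mem_smul_genChiseledBox_iff a b ht z, Finset.mem_coe,
      Finset.mem_sdiff, mem_latticeBox]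
    refine and_congr_right fun hz => ?_
    simp only [hU, Finset.mem_biUnion, Finset.mem_univ, true_and, mem_latticeCorner,
      not_exists, not_and, not_lt]
    exact forall_congr' fun ε => ⟨fun h _ => h, fun h => h hz⟩
  have hBA : ∀ (ε : Fin n → Bool) (i : Fin n),
      B ε + B (Function.update ε i (!ε i)) ≤ A i := by
    intro ε i
    have := Nat.mul_le_mul_right t (hba ε i).le
    rw [add_mul] at this
    simp only [hA, hB]
    exact_mod_cast this
  have hsub : U ⊆ latticeBox A :=
    Finset.biUnion_subset.mpr fun ε _ => Finset.filter_subset _ _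
  have hcardU : U.card = ∑ ε : Fin n → Bool, (b ε * t + n - 1).choose n := by
    rw [hU, Finset.card_biUnion fun ε _ δ _ hne =>
      disjoint_latticeCorner A B (fun ε => Int.natCast_nonneg _) hBA hne]
    refine Finset.sum_congr rfl fun ε _ =>
      card_latticeCorner A ε _ (Nat.mul_pos (hb ε) ht) fun i => ?_
    exact (le_add_of_nonneg_right (Int.natCast_nonneg _)).trans (hBA ε i)
  rw [latticePointCount, hset, Set.ncard_coe_finset, Finset.cast_card_sdiff hsub, hcardU,
    card_latticeBox]
  push_cast
  rfl
end

section
/- Let integers a > 2b > 0 and n ≥ 1, and let Q_n(a,b) = {x ∈ ℝ^n : 0 ≤ x_i ≤ a for all i, and for every ε ∈ {0,1}^n, Σ_{i=1}^n (ε_i(a − x_i) + (1 − ε_i)x_i) ≥ b}. Then Q_n(a,b) is a smooth lattice polytope: it equals the convex hull of a finite subset of ℤ^n, and for each of its vertices v there exist a ℤ-basis u_1, …, u_n of ℤ^n and some δ > 0 such that Q_n(a,b) ∩ B(v, δ) = (v + {Σ_i c_i u_i : c_i ≥ 0}) ∩ B(v, δ). -/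
open Pointwise Polynomial

/-- The coordinates of `x` measured from the vertex of `[0,a]^n` selected by `ε`. -/
def cubeCoord {n : ℕ} (a : ℕ) (ε : Fin n → Bool) (x : Fin n → ℝ) (i : Fin n) : ℝ :=
  if ε i then (a : ℝ) - x i else x i

/-- The direction, `1` or `-1`, of the `i`-th edge of a cube at the vertex selected by `ε`. -/
def cubeSign {n : ℕ} (ε : Fin n → Bool) (i : Fin n) : ℤ := if ε i then -1 else 1

lemma cubeSign_mul_self {n : ℕ} (ε : Fin n → Bool) (i : Fin n) :
    (cubeSign ε i : ℝ) * cubeSign ε i = 1 := by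
  unfold cubeSign
  split_ifs <;> norm_num

lemma isUnit_cubeSign {n : ℕ} (ε : Fin n → Bool) (i : Fin n) : IsUnit (cubeSign ε i) := by
  unfold cubeSign
  split_ifs <;> simp

lemma cubeCoord_add {n : ℕ} (a : ℕ) (ε : Fin n → Bool) (x y : Fin n → ℝ) (i : Fin n) :
    cubeCoord a ε (x + y) i = cubeCoord a ε x i + cubeSign ε i * y i := by
  unfold cubeCoord cubeSign
  split_ifs
  · simp
    ring
  · simp

lemma continuous_cubeCoord {n : ℕ} (a : ℕ) (ε : Fin n → Bool) (i : Fin n) :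
    Continuous fun x => cubeCoord a ε x i := by
  unfold cubeCoord
  split_ifs <;> fun_prop

lemma cubeCoord_injective {n : ℕ} (a : ℕ) (ε : Fin n → Bool) :
    Function.Injective (cubeCoord a ε) := by
  intro x y h
  ext i
  have hi := congrFun h i
  unfold cubeCoord at hi
  split_ifs at hi <;> linarith

lemma mem_chiseledCube {n a b : ℕ} {x : Fin n → ℝ} :
    x ∈ chiseledCube n a b ↔ (∀ i, 0 ≤ x i ∧ x i ≤ (a : ℝ)) ∧
      ∀ ε : Fin n → Bool, (b : ℝ) ≤ ∑ i, cubeCoord a ε x i :=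
  Iff.rfl

/-- Near one of its points, `chiseledCube n a b` is cut out by the `n + 1` inequalities
belonging to a nearest vertex of the cube. -/
lemma exists_eventually_mem_chiseledCube_iff {n a b : ℕ} (hab : 2 * b < a) {x : Fin n → ℝ}
    (hx : x ∈ chiseledCube n a b) :
    ∃ ε : Fin n → Bool, ∀ᶠ z in nhds x, z ∈ chiseledCube n a b ↔
      (∀ i, 0 ≤ cubeCoord a ε z i) ∧ (b : ℝ) ≤ ∑ i, cubeCoord a ε z i := by
  classical
  have hab' : 2 * (b : ℝ) < a := by exact_mod_cast hab
  rw [mem_chiseledCube] at hx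
  obtain ⟨hx, hsum⟩ := hx
  let ε : Fin n → Bool := fun i => decide ((a : ℝ) / 2 < x i)
  have hy (i) : 0 ≤ cubeCoord a ε x i ∧ cubeCoord a ε x i ≤ a / 2 := by
    have := hx i
    by_cases h : (a : ℝ) / 2 < x i
    · simp only [cubeCoord, ε, h, decide_true, if_true]
      constructor <;> linarith
    · simp only [cubeCoord, ε, h, decide_false]
      norm_num
      constructor <;> linarith
  have hcoord (ε' : Fin n → Bool) (i) :
      cubeCoord a ε x i ≤ cubeCoord a ε' x i := by
    have := hx i
    by_cases h : (a : ℝ) / 2 < x i <;> cases h' : ε' i <;>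
      simp [cubeCoord, ε, h, h'] <;> linarith
  have hstrict (ε' : Fin n → Bool) (hε : ε' ≠ ε) :
      (b : ℝ) < ∑ i, cubeCoord a ε' x i := by
    obtain ⟨j, hj⟩ := Function.ne_iff.1 hε
    have hflip : cubeCoord a ε' x j = a - cubeCoord a ε x j := by
      unfold cubeCoord
      cases h : ε j <;> cases h' : ε' j <;> simp_all
    have h0 : (a : ℝ) / 2 ≤ cubeCoord a ε' x j := by linarith [(hy j).2]
    have h1 := Finset.single_le_sum (f := cubeCoord a ε' x)
      (fun i _ => (hy i).1.trans (hcoord ε' i)) (Finset.mem_univ j)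
    linarith
  refine ⟨ε, ?_⟩
  have e1 : ∀ᶠ z in nhds x, ∀ ε' : Fin n → Bool, ε' ≠ ε →
      (b : ℝ) < ∑ i, cubeCoord a ε' z i := by
    rw [Filter.eventually_all]
    intro ε'
    by_cases h : ε' = ε
    · simp [h]
    · have hc : Continuous fun z => ∑ i, cubeCoord a ε' z i :=
        continuous_finsetSum _ fun i _ => continuous_cubeCoord a ε' i
      filter_upwards [continuousAt_const.eventually_lt hc.continuousAt (hstrict ε' h)] with z hz _
        using hz
  have e2 : ∀ᶠ z in nhds x, ∀ i, cubeCoord a ε z i < a := by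
    rw [Filter.eventually_all]
    intro i
    refine (continuous_cubeCoord a ε i).continuousAt.eventually_lt continuousAt_const ?_
    have : (0 : ℝ) ≤ b := b.cast_nonneg
    linarith [(hy i).2]
  filter_upwards [e1, e2] with z h1 h2
  rw [mem_chiseledCube]
  have hbox : (∀ i, 0 ≤ z i ∧ z i ≤ (a : ℝ)) ↔ ∀ i, 0 ≤ cubeCoord a ε z i := by
    refine forall_congr' fun i => ?_
    have := h2 i
    unfold cubeCoord at this ⊢
    split_ifs at this ⊢ <;> constructor <;> grind
  rw [hbox]
  refine and_congr_right fun _ => ⟨fun h => h ε, fun h ε' => ?_⟩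
  by_cases hε : ε' = ε
  · rwa [hε]
  · exact (h1 ε' hε).le

/-- No nontrivial line segment through an extreme point stays inside the set on both sides. -/
lemma eq_zero_of_eventually_add_smul_mem {E : Type*} [AddCommGroup E] [Module ℝ E] {S : Set E}
    {x d : E} (hx : x ∈ S.extremePoints ℝ) (h : ∀ᶠ t : ℝ in nhds 0, x + t • d ∈ S) : d = 0 := by
  have h' : ∀ᶠ t : ℝ in nhds 0, x + (-t) • d ∈ S := by
    have : Filter.Tendsto (fun t : ℝ => -t) (nhds 0) (nhds 0) := by
      simpa using (continuous_neg (G := ℝ)).tendsto 0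
    exact this.eventually h
  obtain ⟨δ, hδ, hball⟩ := Metric.eventually_nhds_iff_ball.1 (h.and h')
  obtain ⟨h1, h2⟩ := hball (δ / 2) (by simp [abs_of_pos, hδ])
  have hmem : x ∈ openSegment ℝ (x + (δ / 2) • d) (x + (-(δ / 2)) • d) := by
    refine ⟨1 / 2, 1 / 2, by norm_num, by norm_num, by norm_num, ?_⟩
    module
  have heq := (mem_extremePoints.1 hx).2 _ h1 _ h2 hmem
  have h3 : (δ / 2) • d = 0 := by simpa using heq.1
  exact (smul_eq_zero.1 h3).resolve_left (by positivity)

/-- At an extreme point, all cube coordinates with respect to a nearby vertex vanish except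
for one, which equals `b`. -/
lemma exists_cubeCoord_eq_single {n a b : ℕ} (hb : 0 < b) {x : Fin n → ℝ}
    {ε : Fin n → Bool} (hx : x ∈ (chiseledCube n a b).extremePoints ℝ)
    (hε : ∀ᶠ z in nhds x, z ∈ chiseledCube n a b ↔
      (∀ i, 0 ≤ cubeCoord a ε z i) ∧ (b : ℝ) ≤ ∑ i, cubeCoord a ε z i) :
    ∃ k, cubeCoord a ε x = Pi.single k (b : ℝ) := by
  obtain ⟨hnn, hsum⟩ := hε.self_of_nhds.1 hx.1
  have hb' : (0 : ℝ) < b := by exact_mod_cast hb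
  have key (d : Fin n → ℝ) (hd : ∀ i, 0 < cubeCoord a ε x i ∨ d i = 0)
      (hds : (b : ℝ) < ∑ i, cubeCoord a ε x i ∨ ∑ i, cubeSign ε i * d i = 0) : d = 0 := by
    refine eq_zero_of_eventually_add_smul_mem hx ?_
    have hline : Continuous fun t : ℝ => x + t • d := by fun_prop
    have hev := (hline.tendsto' 0 x (by simp)).eventually hε
    have e1 : ∀ᶠ t : ℝ in nhds 0, ∀ i, 0 ≤ cubeCoord a ε (x + t • d) i := by
      rw [Filter.eventually_all]
      intro i
      rcases hd i with h | h
      · have hc : ContinuousAt (fun t : ℝ => cubeCoord a ε (x + t • d) i) 0 :=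
          ((continuous_cubeCoord a ε i).comp hline).continuousAt
        filter_upwards [continuousAt_const.eventually_lt hc (by simpa using h)] with t ht using ht.le
      · simp [cubeCoord_add, h, hnn i]
    have e2 : ∀ᶠ t : ℝ in nhds 0, (b : ℝ) ≤ ∑ i, cubeCoord a ε (x + t • d) i := by
      rcases hds with h | h
      · have hc : ContinuousAt (fun t : ℝ => ∑ i, cubeCoord a ε (x + t • d) i) 0 :=
          (continuous_finsetSum _ fun i _ =>
            (continuous_cubeCoord a ε i).comp hline).continuousAt
        filter_upwards [continuousAt_const.eventually_lt hc (by simpa using h)] with t ht using ht.le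
      · refine Filter.Eventually.of_forall fun t => ?_
        have : ∑ i, (cubeSign ε i : ℝ) * (t * d i) = 0 := by
          rw [← mul_zero t, ← h, Finset.mul_sum]
          exact Finset.sum_congr rfl fun i _ => by ring
        simpa [cubeCoord_add, Finset.sum_add_distrib, this] using hsum
    filter_upwards [hev, e1, e2] with t h h1 h2 using h.2 ⟨h1, h2⟩
  obtain ⟨k, -, hk⟩ := Finset.exists_lt_of_sum_lt (s := Finset.univ) (f := fun _ : Fin n => (0 : ℝ))
    (g := cubeCoord a ε x) (by simpa using hb'.trans_le hsum)
  have hsign : (cubeSign ε k : ℝ) ≠ 0 := left_ne_zero_of_mul_eq_one (cubeSign_mul_self ε k)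
  have hzero (j : Fin n) (hjk : j ≠ k) : cubeCoord a ε x j = 0 := by
    by_contra hj
    have h := key (Pi.single k (cubeSign ε k : ℝ) - Pi.single j (cubeSign ε j : ℝ))
      (fun i => by
        by_cases hik : i = k
        · exact Or.inl (hik ▸ hk)
        · by_cases hij : i = j
          · exact Or.inl (hij ▸ (hnn j).lt_of_ne' hj)
          · simp [hik, hij])
      (Or.inr <| by simp [mul_sub, Finset.sum_sub_distrib, Pi.single_apply, cubeSign_mul_self])
    have := congrFun h k
    simp [hjk.symm, hsign] at this
  have hs : ∑ i, cubeCoord a ε x i = cubeCoord a ε x k :=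
    Finset.sum_eq_single k (fun j _ hj => hzero j hj) (by simp)
  have hkb : cubeCoord a ε x k = b := by
    by_contra hne
    have h := key (Pi.single k 1)
      (fun i => by
        by_cases hik : i = k
        · exact Or.inl (hik ▸ hk)
        · simp [hik])
      (Or.inl <| (hsum.lt_of_ne' (hs ▸ hne)))
    simpa using congrFun h k
  refine ⟨k, funext fun j => ?_⟩
  by_cases hj : j = k
  · subst hj
    simpa using hkb
  · simp [hj, hzero j hj]

/-- The integer point whose cube coordinates at the vertex selected by `ε` are `b` at `k` and
`0` elsewhere. -/
def chiseledVertex {n : ℕ} (a b : ℕ) (ε : Fin n → Bool) (k : Fin n) (i : Fin n) : ℤ :=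
  if ε i then (a : ℤ) - (Pi.single k (b : ℤ) : Fin n → ℤ) i
  else (Pi.single k (b : ℤ) : Fin n → ℤ) i

lemma cubeCoord_chiseledVertex {n : ℕ} (a b : ℕ) (ε : Fin n → Bool) (k : Fin n) :
    cubeCoord a ε (intVec (chiseledVertex a b ε k)) = Pi.single k (b : ℝ) := by
  ext i
  by_cases h : i = k <;> cases h' : ε i <;> simp [cubeCoord, intVec, chiseledVertex, h, h'] <;>
    subst h <;> simp [h']

lemma convex_chiseledCube (n a b : ℕ) : Convex ℝ (chiseledCube n a b) := by
  intro x hx y hy s t hs ht hst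
  have hcoord (ε : Fin n → Bool) (i) : cubeCoord a ε (s • x + t • y) i =
      s * cubeCoord a ε x i + t * cubeCoord a ε y i := by
    obtain rfl : t = 1 - s := by linarith
    unfold cubeCoord
    split_ifs <;> simp
    ring
  rw [mem_chiseledCube] at *
  refine ⟨fun i => ?_, fun ε => ?_⟩
  · have := hx.1 i
    have := hy.1 i
    simp only [Pi.add_apply, Pi.smul_apply, smul_eq_mul]
    constructor
    · nlinarith
    · obtain rfl : t = 1 - s := by linarith
      nlinarith
  · have h1 := hx.2 ε
    have h2 := hy.2 ε
    simp only [hcoord, Finset.sum_add_distrib, ← Finset.mul_sum]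
    calc (b : ℝ) = s * b + t * b := by rw [← add_mul, hst, one_mul]
      _ ≤ _ := by gcongr

lemma isCompact_chiseledCube (n a b : ℕ) : IsCompact (chiseledCube n a b) := by
  have hsub : chiseledCube n a b ⊆ Set.Icc 0 (fun _ => (a : ℝ)) :=
    fun x hx => ⟨fun i => (hx.1 i).1, fun i => (hx.1 i).2⟩
  refine isCompact_Icc.of_isClosed_subset ?_ hsub
  have heq : chiseledCube n a b = Set.Icc 0 (fun _ => (a : ℝ)) ∩
      ⋂ ε : Fin n → Bool, {x | (b : ℝ) ≤ ∑ i, cubeCoord a ε x i} := by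
    ext x
    simp [mem_chiseledCube, Pi.le_def, forall_and]
  rw [heq]
  exact isClosed_Icc.inter <| isClosed_iInter fun ε => isClosed_le continuous_const <|
    continuous_finsetSum _ fun i _ => continuous_cubeCoord a ε i

lemma isLatticePolytope_chiseledCube {n a b : ℕ} (hb : 0 < b) (hab : 2 * b < a) :
    IsLatticePolytope (chiseledCube n a b) := by
  classical
  let V : Set (Fin n → ℤ) := {z | intVec z ∈ (chiseledCube n a b).extremePoints ℝ}
  have hform {x : Fin n → ℝ} (hx : x ∈ (chiseledCube n a b).extremePoints ℝ) :
      ∃ ε k, x = intVec (chiseledVertex a b ε k) := by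
    obtain ⟨ε, hε⟩ := exists_eventually_mem_chiseledCube_iff hab hx.1
    obtain ⟨k, hk⟩ := exists_cubeCoord_eq_single hb hx hε
    exact ⟨ε, k, cubeCoord_injective a ε (hk.trans (cubeCoord_chiseledVertex a b ε k).symm)⟩
  have hinj : Function.Injective (intVec (n := n)) := fun x y h =>
    funext fun i => Int.cast_injective (α := ℝ) (congrFun h i)
  have hV : V.Finite := by
    refine (Set.finite_range fun p : (Fin n → Bool) × Fin n =>
      chiseledVertex a b p.1 p.2).subset fun z hz => ?_
    obtain ⟨ε, k, h⟩ := hform hz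
    exact ⟨(ε, k), (hinj h).symm⟩
  have himage : intVec '' V = (chiseledCube n a b).extremePoints ℝ := by
    ext x
    refine ⟨fun ⟨z, hz, h⟩ => h ▸ hz, fun hx => ?_⟩
    obtain ⟨ε, k, rfl⟩ := hform hx
    exact ⟨_, hx, rfl⟩
  refine ⟨hV.toFinset, ?_⟩
  rw [hV.coe_toFinset]
  have hclosed : IsClosed (convexHull ℝ (intVec '' V)) :=
    (hV.image _).isClosed_convexHull ℝ
  rw [← hclosed.closure_eq, himage]
  exact (closure_convexHull_extremePoints (isCompact_chiseledCube n a b)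
    (convex_chiseledCube n a b)).symm

/-- The edge directions of the chiseled cube at `chiseledVertex a b ε k`. -/
def chiseledEdge {n : ℕ} (ε : Fin n → Bool) (k i j : Fin n) : ℤ :=
  ((if i = j then 1 else 0) - if i ≠ k ∧ j = k then 1 else 0) * cubeSign ε j

lemma isZBasis_chiseledEdge {n : ℕ} (ε : Fin n → Bool) (k : Fin n) :
    IsZBasis (chiseledEdge ε k) := by
  have h : Matrix.of (chiseledEdge ε k) =
      (1 + Matrix.vecMulVec (fun i => if i = k then 0 else -1) (Pi.single k 1)) *
        Matrix.diagonal (cubeSign ε) := by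
    ext i j
    rw [Matrix.mul_diagonal]
    by_cases hi : i = k <;> by_cases hj : j = k <;>
      simp [chiseledEdge, Matrix.one_apply, Matrix.vecMulVec_apply, hi, hj]
  rw [IsZBasis, h, Matrix.det_mul, Matrix.det_diagonal, Matrix.vecMulVec_eq Unit,
    Matrix.det_one_add_replicateCol_mul_replicateRow]
  simpa using isUnit_cubeSign ε

lemma cubeSign_mul_sum_chiseledEdge {n : ℕ} (ε : Fin n → Bool) (k j : Fin n) (c : Fin n → ℝ) :
    cubeSign ε j * (∑ i, c i • intVec (chiseledEdge ε k i)) j =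
      c j - if j = k then ∑ i, (if i = k then 0 else c i) else 0 := by
  have h (i : Fin n) : cubeSign ε j * (c i * (chiseledEdge ε k i j : ℝ)) =
      (if i = j then c i else 0) - if j = k then (if i = k then 0 else c i) else 0 := by
    have hs := cubeSign_mul_self ε j
    unfold chiseledEdge
    push_cast
    grind
  simp only [Finset.sum_apply, Pi.smul_apply, smul_eq_mul, intVec, Finset.mul_sum, h,
    Finset.sum_sub_distrib, Finset.sum_ite_eq', Finset.mem_univ, if_true]
  split_ifs <;> simp

lemma isSmooth_chiseledCube {n a b : ℕ} (hb : 0 < b) (hab : 2 * b < a) :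
    IsSmooth (chiseledCube n a b) := by
  intro v hv
  obtain ⟨ε, hε⟩ := exists_eventually_mem_chiseledCube_iff hab hv.1
  obtain ⟨k, hk⟩ := exists_cubeCoord_eq_single hb hv hε
  have hpos : ∀ᶠ z in nhds v, 0 < cubeCoord a ε z k := by
    refine continuousAt_const.eventually_lt (continuous_cubeCoord a ε k).continuousAt ?_
    simpa [hk] using hb
  obtain ⟨δ, hδ, hball⟩ := Metric.eventually_nhds_iff_ball.1 (hε.and hpos)
  refine ⟨chiseledEdge ε k, δ, hδ, isZBasis_chiseledEdge ε k, ?_⟩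
  have hcone (c : Fin n → ℝ) (j : Fin n) :
      cubeCoord a ε (v + ∑ i, c i • intVec (chiseledEdge ε k i)) j =
        (if j = k then (b : ℝ) else 0) +
          (c j - if j = k then ∑ i, (if i = k then 0 else c i) else 0) := by
    rw [cubeCoord_add, cubeSign_mul_sum_chiseledEdge, hk, Pi.single_apply]
  have hsplit (c : Fin n → ℝ) : ∑ i, c i = c k + ∑ i, (if i = k then 0 else c i) := by
    have : ∀ i, c i = (if i = k then c i else 0) + if i = k then 0 else c i := by
      intro i
      split_ifs <;> simp
    rw [Finset.sum_congr rfl fun i _ => this i, Finset.sum_add_distrib]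
    simp
  ext x
  refine and_congr_left fun hxb => ?_
  obtain ⟨hiff, hxk⟩ := hball x hxb
  rw [hiff]
  constructor
  · rintro ⟨h1, h2⟩
    refine ⟨fun i => if i = k then ∑ i, cubeCoord a ε x i - b else cubeCoord a ε x i, ?_, ?_⟩
    · intro i
      dsimp only
      split_ifs
      · linarith
      · exact h1 i
    · refine cubeCoord_injective a ε (funext fun j => ?_)
      rw [hcone]
      by_cases hj : j = k
      · subst hj
        have hr : ∑ i, (if i = j then 0 else
            if i = j then ∑ i, cubeCoord a ε x i - b else cubeCoord a ε x i) =
            ∑ i, if i = j then 0 else cubeCoord a ε x i :=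
          Finset.sum_congr rfl fun i _ => by split_ifs <;> rfl
        simp only [if_true, hr]
        linarith [hsplit (cubeCoord a ε x)]
      · simp [hj]
  · rintro ⟨c, hc, hxc⟩
    have hcoord (j : Fin n) := hxc ▸ hcone c j
    refine ⟨fun i => ?_, ?_⟩
    · by_cases hi : i = k
      · exact hi ▸ hxk.le
      · simpa [hcoord, hi] using hc i
    · have hsum : ∑ i, cubeCoord a ε x i = b + c k := by
        simp only [hcoord, Finset.sum_add_distrib, Finset.sum_sub_distrib, Finset.sum_ite_eq',
          Finset.mem_univ, if_true, hsplit c]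
        ring
      linarith [hc k]

/-- For integers `a > 2b > 0` and `n ≥ 1`, the fully chiseled cube `Q_n(a,b)` is a
smooth lattice polytope. -/
theorem chiseledCube_isSmooth (a b n : ℕ) (hb : 0 < b) (hab : 2 * b < a) (hn : 1 ≤ n) :
    IsLatticePolytope (chiseledCube n a b) ∧ IsSmooth (chiseledCube n a b) := by
  exact ⟨isLatticePolytope_chiseledCube hb hab, isSmooth_chiseledCube hb hab⟩
end
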